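/- arXiv:2110.05716 — 3 statements merged into one kernel-verified Lean document; each statement's English description precedes it below -/
import Mathlib

section
/- A priori L^p bound with explicit constants (inequality (2.38)): under Assumption 2.1 and the probabilistic setup below with ξ ∈ L^p, for p ≥ 2, define c_{p,m} = ((m²−m)/2)p² + 2mp² + m/2, C₀ = T‖ϕ(0)‖ + T·c_{p,m}·max_{1≤j₁,j₂≤m}‖L^{j₁}g_{j₂}(0)‖ + p·√(Tm)·‖g(0)‖, and C₁ = 2(K²c_{p,m}²T + p²mK² + K²T)·T. Then sup_{0≤n≤N} ‖Y_n‖_{L^p(Ω;ℝ^d)} ≤ 2·exp(C₁)·( ‖ξ‖_{L^p(Ω;ℝ^d)} + N + C₀ ). -/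
open MeasureTheory ProbabilityTheory Real Finset
open scoped RealInnerProductSpace ENNReal NNReal

noncomputable section

abbrev Vec (n : ℕ) : Type := EuclideanSpace ℝ (Fin n)

/-- The `d × m` matrix with columns `g j x`, viewed as a continuous linear map `ℝ^m → ℝ^d`. -/
def Gclm {d m : ℕ} (g : Fin m → Vec d → Vec d) (x : Vec d) : Vec m →L[ℝ] Vec d :=
  LinearMap.toContinuousLinearMap
  { toFun := fun w => ∑ j, w j • g j x
    map_add' := by
      intro w w'
      simp [PiLp.add_apply, add_smul, Finset.sum_add_distrib]
    map_smul' := by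
      intro c w
      simp [PiLp.smul_apply, smul_smul, Finset.smul_sum] }

/-- `L^{j₁} g_{j₂} (x) = (Dg_{j₂})(x) · g_{j₁}(x)`. -/
def Lg {d m : ℕ} (g : Fin m → Vec d → Vec d) (j₁ j₂ : Fin m) (x : Vec d) : Vec d :=
  fderiv ℝ (g j₂) x (g j₁ x)

/-- One step of the semi-tamed Milstein scheme with stepsize `h`, drift parts `ph` (Lipschitz)
and `ps` (tamed), diffusion columns `g`, current state `y` and Brownian increment `w`. -/
def milstep {d m : ℕ} (h : ℝ) (ph ps : Vec d → Vec d) (g : Fin m → Vec d → Vec d)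
    (y : Vec d) (w : Vec m) : Vec d :=
  y + h • ph y + (h / (1 + ‖ps y‖ * h)) • ps y + Gclm g y w
    + (2⁻¹ : ℝ) • ∑ j₁, ∑ j₂, (w j₁ * w j₂ - (if j₁ = j₂ then h else 0)) • Lg g j₁ j₂ y

/-- The quantity `α` associated with a state `y` and an increment `w`. -/
def alph {d m : ℕ} (h : ℝ) (g : Fin m → Vec d → Vec d) (y : Vec d) (w : Vec m) : ℝ :=
  if 1 ≤ ‖y‖ then
    ⟪‖y‖⁻¹ • y, ‖y‖⁻¹ • (Gclm g y w)⟫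
      + ⟪‖y‖⁻¹ • y,
          (2 * ‖y‖)⁻¹ • ∑ j₁, ∑ j₂, (w j₁ * w j₂ - (if j₁ = j₂ then h else 0)) • Lg g j₁ j₂ y⟫
  else 0

/-- The constant `λ`. -/
def lamc {d m : ℕ} (T K : ℝ) (ph ps : Vec d → Vec d) (g : Fin m → Vec d → Vec d) : ℝ :=
  (1 + 4 * T * K + 2 * T * (‖ph 0‖ + ‖ps 0‖) + 2 * K + 2 * ‖Gclm g 0‖
    + (m : ℝ) ^ 2 * (T + 1) * (K + ⨆ j : Fin m × Fin m, ‖Lg g j.1 j.2 0‖)) ^ 2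

/-- The dominating process `D_n`, given `λ`, `‖ξ‖`, the squared increment norms and the `α`'s. -/
def Dproc (lam ξnorm : ℝ) (w2 al : ℕ → ℝ) (n : ℕ) : ℝ :=
  (lam + ξnorm) * Real.exp (lam +
    (Finset.range (n + 1)).sup' Finset.nonempty_range_add_one
      (fun u => ∑ k ∈ Finset.Ico u n, (lam * w2 k + al k)))

end

noncomputable section

lemma one_add_rpow_mul_one_sub_le {r t : ℝ} (hr : 1 ≤ r) (ht0 : 0 ≤ t) (ht1 : t < 1) :
    (1 + t) ^ r * (1 - r * t) ≤ (1 - t) ^ r * (1 + r * t) := by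
  have hr0 : 0 ≤ r := by linarith
  have hp1 : 0 < 1 - t := by linarith
  have hp2 : 0 < 1 + t := by linarith
  have hrt : 0 ≤ r * t := by positivity
  rcases le_or_gt 1 (r * t) with h | h
  · exact (mul_nonpos_of_nonneg_of_nonpos (by positivity) (by linarith)).trans (by positivity)
  have hq : 0 < 1 - r * t := by linarith
  have h1 := (hasSum_log_sub_log_of_abs_lt_one (x := t) (by rwa [abs_of_nonneg ht0])).mul_left r
  have h2 := hasSum_log_sub_log_of_abs_lt_one (x := r * t) (by rwa [abs_of_nonneg hrt])
  have h3 := hasSum_le (fun k => by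
    have : r ≤ r ^ (2 * k + 1) := le_self_pow₀ hr (by omega)
    have h4 : r * t ^ (2 * k + 1) ≤ (r * t) ^ (2 * k + 1) := by
      rw [mul_pow]; gcongr
    calc r * ((2 : ℝ) * (1 / (2 * k + 1)) * t ^ (2 * k + 1))
        = (2 : ℝ) * (1 / (2 * k + 1)) * (r * t ^ (2 * k + 1)) := by ring
      _ ≤ (2 : ℝ) * (1 / (2 * k + 1)) * (r * t) ^ (2 * k + 1) := by gcongr) h1 h2
  rw [← Real.log_le_log_iff (by positivity) (by positivity), Real.log_mul (by positivity) hq.ne',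
    Real.log_mul (by positivity) (by positivity), Real.log_rpow hp2, Real.log_rpow hp1]
  linarith

lemma one_add_rpow_add_one_sub_rpow_le {p t : ℝ} (hp : 2 ≤ p) (ht0 : 0 ≤ t) (ht1 : t ≤ 1) :
    ((1 + t) ^ p + (1 - t) ^ p) / 2 ≤ (1 + (p - 1) * t ^ 2) ^ (p / 2) := by
  have hpos : ∀ t : ℝ, 0 < 1 + (p - 1) * t ^ 2 := fun t => by nlinarith [sq_nonneg t]
  let H : ℝ → ℝ := fun t => ((1 + t) ^ p + (1 - t) ^ p) * (1 + (p - 1) * t ^ 2) ^ (-(p / 2))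
  have hderiv : ∀ t ∈ Set.Ioo (0 : ℝ) 1, HasDerivAt H
      ((1 * p * (1 + t) ^ (p - 1) + (-1) * p * (1 - t) ^ (p - 1))
          * (1 + (p - 1) * t ^ 2) ^ (-(p / 2))
        + ((1 + t) ^ p + (1 - t) ^ p)
          * (((p - 1) * (2 * t)) * (-(p / 2)) * (1 + (p - 1) * t ^ 2) ^ (-(p / 2) - 1))) t := by
    intro t ht
    have a1 : HasDerivAt (fun t : ℝ => 1 + t) 1 t := (hasDerivAt_id t).const_add 1
    have a2 : HasDerivAt (fun t : ℝ => 1 - t) (-1) t := (hasDerivAt_id t).const_sub 1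
    have a3 : HasDerivAt (fun t : ℝ => 1 + (p - 1) * t ^ 2) ((p - 1) * (2 * t)) t := by
      have := ((hasDerivAt_pow 2 t).const_mul (p - 1)).const_add 1
      simpa using this
    have b1 := a1.rpow_const (p := p) (Or.inl (by linarith [ht.1]))
    have b2 := a2.rpow_const (p := p) (Or.inl (by linarith [ht.2]))
    have b3 := a3.rpow_const (p := -(p / 2)) (Or.inl (hpos t).ne')
    exact (b1.add b2).mul b3
  have hanti : AntitoneOn H (Set.Icc 0 1) := by
    refine antitoneOn_of_deriv_nonpos (convex_Icc 0 1) ?_ ?_ ?_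
    · refine ContinuousOn.mul (ContinuousOn.add ?_ ?_) ?_
      · exact ContinuousOn.rpow_const (by fun_prop) (fun x _ => Or.inr (by linarith))
      · exact ContinuousOn.rpow_const (by fun_prop) (fun x _ => Or.inr (by linarith))
      · exact ContinuousOn.rpow_const (by fun_prop) (fun x _ => Or.inl (hpos x).ne')
    · rw [interior_Icc]
      exact fun t ht => (hderiv t ht).differentiableAt.differentiableWithinAt
    · rw [interior_Icc]
      intro t ht
      rw [(hderiv t ht).deriv]
      have hA : (1 + t) ^ p = (1 + t) ^ (p - 1) * (1 + t) := by
        rw [← Real.rpow_add_one (by linarith [ht.1]), sub_add_cancel]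
      have hB : (1 - t) ^ p = (1 - t) ^ (p - 1) * (1 - t) := by
        rw [← Real.rpow_add_one (by linarith [ht.2]), sub_add_cancel]
      have hC : (1 + (p - 1) * t ^ 2) ^ (-(p / 2))
          = (1 + (p - 1) * t ^ 2) ^ (-(p / 2) - 1) * (1 + (p - 1) * t ^ 2) := by
        rw [← Real.rpow_add_one (hpos t).ne', sub_add_cancel]
      have key := one_add_rpow_mul_one_sub_le (r := p - 1) (by linarith) ht.1.le ht.2
      rw [hA, hB, hC]
      have hCpos : 0 ≤ (1 + (p - 1) * t ^ 2) ^ (-(p / 2) - 1) := Real.rpow_nonneg (hpos t).le _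
      generalize (1 + (p - 1) * t ^ 2) ^ (-(p / 2) - 1) = C at *
      generalize (1 + t) ^ (p - 1) = A at *
      generalize (1 - t) ^ (p - 1) = B at *
      have h2 : p * C * (A * (1 - (p - 1) * t) - B * (1 + (p - 1) * t)) ≤ 0 :=
        mul_nonpos_of_nonneg_of_nonpos (mul_nonneg (by linarith) hCpos) (by linarith)
      calc _ = p * C * (A * (1 - (p - 1) * t) - B * (1 + (p - 1) * t)) := by ring
        _ ≤ 0 := h2
  have h01 := hanti (Set.left_mem_Icc.2 zero_le_one) ⟨ht0, ht1⟩ ht0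
  simp only [H] at h01
  norm_num at h01
  rw [Real.rpow_neg (hpos t).le] at h01
  rw [div_le_iff₀ two_pos]
  have hD : 0 < (1 + (p - 1) * t ^ 2) ^ (p / 2) := Real.rpow_pos_of_pos (hpos t) _
  rw [← div_eq_mul_inv, div_le_iff₀ hD] at h01
  linarith

lemma add_rpow_add_abs_sub_rpow_le {p s t : ℝ} (hp : 2 ≤ p) (hs : 0 ≤ s) (ht : 0 ≤ t) :
    ((s + t) ^ p + |s - t| ^ p) / 2 ≤ (s ^ 2 + (p - 1) * t ^ 2) ^ (p / 2) := by
  have main : ∀ s t : ℝ, 0 ≤ t → t ≤ s →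
      ((s + t) ^ p + |s - t| ^ p) / 2 ≤ (s ^ 2 + (p - 1) * t ^ 2) ^ (p / 2) := by
    intro s t ht hts
    rcases ht.eq_or_lt with rfl | ht'
    · have : (s ^ 2) ^ (p / 2) = s ^ p := by
        rw [← Real.rpow_natCast, ← Real.rpow_mul hts]; congr 1; push_cast; ring
      simp [abs_of_nonneg hts, this]
    have hs : 0 < s := ht'.trans_le hts
    have hdiv : t / s ≤ 1 := (div_le_one hs).2 hts
    have h := one_add_rpow_add_one_sub_rpow_le hp (div_nonneg ht hs.le) hdiv
    have h1 : s + t = s * (1 + t / s) := by field_simp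
    have h2 : s - t = s * (1 - t / s) := by field_simp
    have h3 : s ^ 2 + (p - 1) * t ^ 2 = s ^ 2 * (1 + (p - 1) * (t / s) ^ 2) := by field_simp
    have h4 : 0 ≤ (p - 1) * (t / s) ^ 2 := mul_nonneg (by linarith) (sq_nonneg _)
    have h5 : (s ^ 2) ^ (p / 2) = s ^ p := by
      rw [← Real.rpow_natCast, ← Real.rpow_mul hs.le]; congr 1; push_cast; ring
    rw [abs_of_nonneg (by linarith), h1, h2, h3, Real.mul_rpow hs.le (by positivity),
      Real.mul_rpow hs.le (by linarith), Real.mul_rpow (by positivity) (by linarith), h5, ← mul_add,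
      mul_div_assoc]
    gcongr
  rcases le_total t s with h | h
  · exact main s t ht h
  · rw [add_comm s t, abs_sub_comm]
    refine (main t s hs h).trans (Real.rpow_le_rpow ?_ ?_ (by linarith))
    · nlinarith [sq_nonneg t, sq_nonneg s]
    · nlinarith [mul_nonneg (sub_nonneg.2 hp) (mul_nonneg (sub_nonneg.2 h) (add_nonneg hs ht))]

/-- For a convex function, the symmetric mean over `a ± b` grows with `|b|`. -/
lemma rpow_add_rpow_sub_le {q a b c : ℝ} (hq : 1 ≤ q) (hbc : |b| ≤ c) (hca : c ≤ a) :
    (a + b) ^ q + (a - b) ^ q ≤ (a + c) ^ q + (a - c) ^ q := by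
  obtain ⟨hb1, hb2⟩ := abs_le.1 hbc
  rcases ((abs_nonneg b).trans hbc).eq_or_lt with rfl | hc
  · have : b = 0 := by simpa using hbc
    simp [this]
  have hconv := convexOn_rpow hq
  have m1 : a + c ∈ Set.Ici (0 : ℝ) := by simp; linarith
  have m2 : a - c ∈ Set.Ici (0 : ℝ) := by simp; linarith
  have w1 : 0 ≤ (c + b) / (2 * c) := div_nonneg (by linarith) (by linarith)
  have w2 : 0 ≤ (c - b) / (2 * c) := div_nonneg (by linarith) (by linarith)
  have f3 : (c + b) / (2 * c) + (c - b) / (2 * c) = 1 := by field_simp; ring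
  have e1 := hconv.2 m1 m2 w1 w2 f3
  have e2 := hconv.2 m1 m2 w2 w1 ((add_comm _ _).trans f3)
  simp only [smul_eq_mul] at e1 e2
  have f1 : (c + b) / (2 * c) * (a + c) + (c - b) / (2 * c) * (a - c) = a + b := by
    field_simp; ring
  have f2 : (c - b) / (2 * c) * (a + c) + (c + b) / (2 * c) * (a - c) = a - b := by
    field_simp; ring
  rw [f1] at e1
  rw [f2] at e2
  calc _ ≤ _ := add_le_add e1 e2
    _ = ((c + b) / (2 * c) + (c - b) / (2 * c)) * ((a + c) ^ q + (a - c) ^ q) := by ring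
    _ = _ := by rw [f3, one_mul]

/-- The two-point inequality expressing 2-uniform smoothness of Hilbert spaces in `L^p`. -/
lemma norm_add_rpow_add_norm_sub_rpow_le {E : Type*} [NormedAddCommGroup E]
    [InnerProductSpace ℝ E] {p : ℝ} (hp : 2 ≤ p) (x y : E) :
    (‖x + y‖ ^ p + ‖x - y‖ ^ p) / 2 ≤ (‖x‖ ^ 2 + (p - 1) * ‖y‖ ^ 2) ^ (p / 2) := by
  have hsq : ∀ u : ℝ, 0 ≤ u → u ^ p = (u ^ 2) ^ (p / 2) := by
    intro u hu
    rw [← Real.rpow_natCast, ← Real.rpow_mul hu]; congr 1; push_cast; ring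
  refine le_trans ?_ (add_rpow_add_abs_sub_rpow_le hp (norm_nonneg x) (norm_nonneg y))
  have h := rpow_add_rpow_sub_le (q := p / 2) (a := ‖x‖ ^ 2 + ‖y‖ ^ 2) (b := 2 * ⟪x, y⟫)
    (c := 2 * (‖x‖ * ‖y‖)) (by linarith)
    (by rw [abs_mul, abs_two]; gcongr; exact abs_real_inner_le_norm x y)
    (by nlinarith [sq_nonneg (‖x‖ - ‖y‖)])
  rw [hsq _ (norm_nonneg _), hsq _ (norm_nonneg _), hsq (‖x‖ + ‖y‖) (by positivity),
    hsq _ (abs_nonneg _), sq_abs, norm_add_sq_real, norm_sub_sq_real]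
  have e1 : ‖x‖ ^ 2 + 2 * ⟪x, y⟫ + ‖y‖ ^ 2 = ‖x‖ ^ 2 + ‖y‖ ^ 2 + 2 * ⟪x, y⟫ := by ring
  have e2 : ‖x‖ ^ 2 - 2 * ⟪x, y⟫ + ‖y‖ ^ 2 = ‖x‖ ^ 2 + ‖y‖ ^ 2 - 2 * ⟪x, y⟫ := by ring
  have e3 : (‖x‖ + ‖y‖) ^ 2 = ‖x‖ ^ 2 + ‖y‖ ^ 2 + 2 * (‖x‖ * ‖y‖) := by ring
  have e4 : (‖x‖ - ‖y‖) ^ 2 = ‖x‖ ^ 2 + ‖y‖ ^ 2 - 2 * (‖x‖ * ‖y‖) := by ring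
  rw [e1, e2, e3, e4]
  linarith

variable {Ω E F : Type*} {mΩ : MeasurableSpace Ω} {P : Measure Ω}

lemma eLpNorm_ofReal_rpow {ε : Type*} [ENorm ε] {p : ℝ} (hp : 0 < p) (f : Ω → ε) :
    eLpNorm f (ENNReal.ofReal p) P ^ p = ∫⁻ ω, ‖f ω‖ₑ ^ p ∂P := by
  rw [eLpNorm_eq_lintegral_rpow_enorm_toReal (by simpa using hp) ENNReal.ofReal_ne_top,
    ENNReal.toReal_ofReal hp.le, ← ENNReal.rpow_mul, one_div_mul_cancel hp.ne', ENNReal.rpow_one]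

lemma eLpNorm_norm_sq [NormedAddCommGroup E] {p : ℝ} (hp : 0 ≤ p) (f : Ω → E) :
    eLpNorm (fun ω => ‖f ω‖ ^ 2) (ENNReal.ofReal p) P
      = eLpNorm f (ENNReal.ofReal (2 * p)) P ^ 2 := by
  have h := eLpNorm_norm_rpow (p := ENNReal.ofReal p) (μ := P) f (q := 2) two_pos
  rw [← ENNReal.ofReal_mul hp, mul_comm p 2] at h
  exact_mod_cast h

/-- Adding a conditionally symmetric increment: a one-step Burkholder type inequality. -/
lemma eLpNorm_add_sq_le_of_symmetric [NormedAddCommGroup E] [InnerProductSpace ℝ E]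
    [MeasurableSpace E] [BorelSpace E] [SecondCountableTopology E] {p : ℝ} (hp : 2 ≤ p)
    {U V : Ω → E} (hU : Measurable U) (hV : Measurable V)
    (hsymm : eLpNorm (fun ω => U ω - V ω) (ENNReal.ofReal p) P
      = eLpNorm (fun ω => U ω + V ω) (ENNReal.ofReal p) P) :
    eLpNorm (fun ω => U ω + V ω) (ENNReal.ofReal p) P ^ 2
      ≤ eLpNorm U (ENNReal.ofReal p) P ^ 2
        + ENNReal.ofReal (p - 1) * eLpNorm V (ENNReal.ofReal p) P ^ 2 := by
  have hp0 : 0 < p := by linarith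
  have hp1 : 0 ≤ p - 1 := by linarith
  have hpoint : ∀ ω, ‖U ω + V ω‖ₑ ^ p + ‖U ω - V ω‖ₑ ^ p
      ≤ 2 * ‖‖U ω‖ ^ 2 + (p - 1) * ‖V ω‖ ^ 2‖ₑ ^ (p / 2) := by
    intro ω
    have h := norm_add_rpow_add_norm_sub_rpow_le hp (U ω) (V ω)
    have hs : 0 ≤ ‖U ω‖ ^ 2 + (p - 1) * ‖V ω‖ ^ 2 := by positivity
    rw [← ofReal_norm, ← ofReal_norm, ← ofReal_norm, Real.norm_of_nonneg hs,
      ENNReal.ofReal_rpow_of_nonneg (norm_nonneg _) hp0.le,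
      ENNReal.ofReal_rpow_of_nonneg (norm_nonneg _) hp0.le,
      ENNReal.ofReal_rpow_of_nonneg hs (by positivity),
      ← ENNReal.ofReal_add (by positivity) (by positivity),
      ← ENNReal.ofReal_ofNat 2, ← ENNReal.ofReal_mul (by positivity)]
    exact ENNReal.ofReal_le_ofReal (by linarith)
  have hlint : eLpNorm (fun ω => U ω + V ω) (ENNReal.ofReal p) P ^ p
      ≤ eLpNorm (fun ω => ‖U ω‖ ^ 2 + (p - 1) * ‖V ω‖ ^ 2) (ENNReal.ofReal (p / 2)) P ^ (p / 2) := by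
    have h1 := eLpNorm_ofReal_rpow (P := P) hp0 (fun ω => U ω + V ω)
    have h2 := eLpNorm_ofReal_rpow (P := P) hp0 (fun ω => U ω - V ω)
    rw [hsymm] at h2
    rw [eLpNorm_ofReal_rpow (p := p / 2) (by positivity)]
    have h3 := lintegral_mono (μ := P) hpoint
    rw [lintegral_add_left (by fun_prop), lintegral_const_mul' _ _ (by simp), ← h1, ← h2, ← two_mul]
      at h3
    exact (ENNReal.mul_le_mul_iff_right two_ne_zero ENNReal.ofNat_ne_top).1 h3
  have hsq : eLpNorm (fun ω => U ω + V ω) (ENNReal.ofReal p) P ^ 2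
      ≤ eLpNorm (fun ω => ‖U ω‖ ^ 2 + (p - 1) * ‖V ω‖ ^ 2) (ENNReal.ofReal (p / 2)) P := by
    rw [← ENNReal.rpow_le_rpow_iff (z := p / 2) (by positivity), ← ENNReal.rpow_natCast,
      ← ENNReal.rpow_mul]
    convert hlint using 2
    push_cast; ring
  refine hsq.trans ((eLpNorm_add_le (by fun_prop) (by fun_prop) ?_).trans (add_le_add ?_ ?_))
  · rw [← ENNReal.ofReal_one]; exact ENNReal.ofReal_le_ofReal (by linarith)
  · rw [eLpNorm_norm_sq (by positivity), mul_div_cancel₀ _ (two_ne_zero)]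
  · refine (eLpNorm_le_mul_eLpNorm_of_ae_le_mul (g := fun ω => ‖V ω‖ ^ 2) (c := p - 1)
      (Filter.Eventually.of_forall fun ω => ?_) _).trans ?_
    · rw [norm_mul, Real.norm_of_nonneg hp1]
    · rw [eLpNorm_norm_sq (by positivity), mul_div_cancel₀ _ (two_ne_zero)]

lemma eLpNorm_smul_of_indepFun [NormedAddCommGroup E] [NormedSpace ℝ E] [MeasurableSpace E]
    [BorelSpace E] {p : ℝ} (hp : 0 < p) {a : Ω → ℝ} {b : Ω → E} (ha : Measurable a)
    (hb : Measurable b) (hab : IndepFun a b P) :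
    eLpNorm (fun ω => a ω • b ω) (ENNReal.ofReal p) P
      = eLpNorm a (ENNReal.ofReal p) P * eLpNorm b (ENNReal.ofReal p) P := by
  have hi : IndepFun (fun ω => ‖a ω‖ₑ ^ p) (fun ω => ‖b ω‖ₑ ^ p) P :=
    hab.comp (φ := fun x => ‖x‖ₑ ^ p) (ψ := fun x => ‖x‖ₑ ^ p) (by fun_prop) (by fun_prop)
  have h := lintegral_mul_eq_lintegral_mul_lintegral_of_indepFun'' (μ := P) (by fun_prop)
    (by fun_prop) hi
  apply ENNReal.rpow_left_injective hp.ne'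
  simp only
  rw [ENNReal.mul_rpow_of_nonneg _ _ hp.le, eLpNorm_ofReal_rpow hp,
    eLpNorm_ofReal_rpow hp, eLpNorm_ofReal_rpow hp, ← h]
  refine lintegral_congr fun ω => ?_
  rw [enorm_smul, ENNReal.mul_rpow_of_nonneg _ _ hp.le]

/-- Absolute moments of a centred Gaussian variable of variance `h`. -/
lemma eLpNorm_gaussianReal_le {q h : ℝ} (hq : 2 ≤ q) (hh : 0 < h) :
    eLpNorm (fun x : ℝ => x) (ENNReal.ofReal q) (gaussianReal 0 h.toNNReal)
      ≤ ENNReal.ofReal (√(q * h)) := by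
  have hq0 : 0 < q := by linarith
  set ν := gaussianReal 0 h.toNNReal
  set l := √(q / h) with hl
  have hlpos : 0 < l := Real.sqrt_pos.2 (by positivity)
  have hlsq : l ^ 2 * h = q := by rw [hl, Real.sq_sqrt (by positivity)]; field_simp
  have hs : √(q * h) = q / l := by
    rw [eq_div_iff hlpos.ne', hl, ← Real.sqrt_mul (by positivity)]
    rw [show q * h * (q / h) = q ^ 2 by field_simp, Real.sqrt_sq hq0.le]
  have hpoint : ∀ x : ℝ, ‖x‖ₑ ^ q
      ≤ ENNReal.ofReal ((q / l) ^ q * Real.exp (-q) * (Real.exp (l * x) + Real.exp (-l * x))) := by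
    intro x
    rw [← ofReal_norm, ENNReal.ofReal_rpow_of_nonneg (norm_nonneg _) hq0.le, Real.norm_eq_abs]
    refine ENNReal.ofReal_le_ofReal ?_
    have h1 : |x| = (q / l) * (l * |x| / q) := by field_simp
    have h2 : l * |x| / q ≤ Real.exp (l * |x| / q - 1) := by
      have := Real.add_one_le_exp (l * |x| / q - 1); linarith
    have h3 : Real.exp (l * |x|) ≤ Real.exp (l * x) + Real.exp (-l * x) := by
      rcases abs_choice x with h | h <;> rw [h]
      · linarith [Real.exp_pos (-l * x)]
      · rw [mul_neg, ← neg_mul]; linarith [Real.exp_pos (l * x)]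
    calc |x| ^ q = (q / l) ^ q * (l * |x| / q) ^ q := by
          conv_lhs => rw [h1]
          rw [Real.mul_rpow (by positivity) (by positivity)]
      _ ≤ (q / l) ^ q * (Real.exp (l * |x| / q - 1)) ^ q := by gcongr
      _ = (q / l) ^ q * Real.exp (-q) * Real.exp (l * |x|) := by
          rw [← Real.exp_mul, mul_assoc, ← Real.exp_add]; congr 2; field_simp; ring
      _ ≤ _ := by gcongr
  have hmgf : ∀ t : ℝ, ∫ x, Real.exp (t * x) ∂ν = Real.exp (h * t ^ 2 / 2) := by
    intro t
    have := mgf_gaussianReal (p := ν) (X := fun x => x) (μ := 0) (v := h.toNNReal)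
      (by simp [ν, Measure.map_id']) t
    simpa [mgf, hh.le] using this
  have hint : ∀ t : ℝ, Integrable (fun x => Real.exp (t * x)) ν :=
    fun t => integrable_exp_mul_gaussianReal t
  rw [← ENNReal.rpow_le_rpow_iff (z := q) hq0, eLpNorm_ofReal_rpow hq0,
    ENNReal.ofReal_rpow_of_nonneg (by positivity) hq0.le]
  refine (lintegral_mono hpoint).trans ?_
  have hsum : Integrable (fun x => (q / l) ^ q * Real.exp (-q)
      * (Real.exp (l * x) + Real.exp (-l * x))) ν := ((hint l).add (hint (-l))).const_mul _
  rw [← ofReal_integral_eq_lintegral_ofReal hsum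
    (Filter.Eventually.of_forall fun x => by positivity)]
  refine ENNReal.ofReal_le_ofReal ?_
  rw [integral_const_mul, integral_add (hint l) (hint (-l)), hmgf, hmgf, neg_sq, mul_comm h, hlsq,
    hs, mul_assoc]
  refine mul_le_of_le_one_right (by positivity) ?_
  rw [← two_mul, mul_left_comm, ← Real.exp_add, show -q + q / 2 = -(q / 2) by ring, Real.exp_neg,
    ← div_eq_mul_inv, div_le_one (Real.exp_pos _)]
  linarith [Real.add_one_le_exp (q / 2)]

/-- If `X` is independent of `(A, B)` and `A` of `B`, then `(X, A)` is independent of `B`. -/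
lemma IndepFun.prodMk_left_of_prodMk_right {α β γ : Type*} [MeasurableSpace α] [MeasurableSpace β]
    [MeasurableSpace γ] [IsProbabilityMeasure P] {X : Ω → α} {A : Ω → β} {B : Ω → γ}
    (hX : Measurable X) (hA : Measurable A) (hB : Measurable B)
    (h : IndepFun X (fun ω => (A ω, B ω)) P) (hAB : IndepFun A B P) :
    IndepFun (fun ω => (X ω, A ω)) B P := by
  have := Measure.isProbabilityMeasure_map (μ := P) hX.aemeasurable
  have := Measure.isProbabilityMeasure_map (μ := P) hA.aemeasurable
  have := Measure.isProbabilityMeasure_map (μ := P) hB.aemeasurable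
  have hXA : IndepFun X A P := h.comp measurable_id measurable_fst
  rw [indepFun_iff_map_prod_eq_prod_map_map (by fun_prop) (by fun_prop)] at h hAB hXA ⊢
  rw [hXA]
  have e : (fun ω => ((X ω, A ω), B ω))
      = MeasurableEquiv.prodAssoc.symm ∘ (fun ω => (X ω, (A ω, B ω))) := rfl
  rw [e, ← Measure.map_map (by fun_prop) (by fun_prop), h, hAB]
  exact ((measurePreserving_prodAssoc _ _ _).symm _).map_eq

lemma iIndepFun.indepFun_tail {β : Type*} [MeasurableSpace β] {W : ℕ → Ω → β}
    (hW : ∀ k, Measurable (W k)) (h : iIndepFun W P) (n : ℕ) :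
    IndepFun (W n) (fun ω k => W (n + 1 + k) ω) P := by
  have h1 := indep_iSup_of_disjoint (fun i => (hW i).comap_le) h.iIndep
    (S := {n}) (T := Set.Ioi n) (by simp)
  refine indep_of_indep_of_le_left (indep_of_indep_of_le_right h1 ?_) ?_
  · simp only [MeasurableSpace.pi, MeasurableSpace.comap_iSup, MeasurableSpace.comap_comp]
    exact iSup_le fun k => le_iSup₂_of_le (n + 1 + k) (by simp; omega) le_rfl
  · simp

lemma le_mul_one_add_pow_of_le_add_sum {N : ℕ} {B ε : ℝ} (hε : 0 ≤ ε) {b : ℕ → ℝ}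
    (hb : ∀ n ≤ N, b n ≤ B + ε * ∑ k ∈ range n, b k) :
    ∀ n ≤ N, b n ≤ B * (1 + ε) ^ n := by
  have key : ∀ n ≤ N, B + ε * ∑ k ∈ range n, b k ≤ B * (1 + ε) ^ n := by
    intro n
    induction n with
    | zero => simp
    | succ n ih =>
      intro hn
      have h1 := ih (by omega)
      have h2 := mul_le_mul_of_nonneg_left ((hb n (by omega)).trans h1) hε
      rw [sum_range_succ, pow_succ]
      linarith
  exact fun n hn => (hb n hn).trans (key n hn)

lemma add_four_sq_le (a b c d : ℝ) :
    (a + b + c + d) ^ 2 ≤ 4 * (a ^ 2 + b ^ 2 + c ^ 2 + d ^ 2) := by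
  linarith [sq_nonneg (a - b), sq_nonneg (a - c), sq_nonneg (a - d), sq_nonneg (b - c),
    sq_nonneg (b - d), sq_nonneg (c - d)]

/-- A Grönwall inequality mixing an `ℓ¹` drift and an `ℓ²` martingale contribution. -/
lemma le_two_mul_exp_of_drift_of_quadratic {N : ℕ} (hN : 0 < N) {T K p c x f₀ l₀ g₀ : ℝ} {m : ℕ}
    (hT : 0 < T) (hK : 0 ≤ K) (hp : 0 ≤ p) (hc : 0 ≤ c) (hx : 0 ≤ x) (hf₀ : 0 ≤ f₀) (hl₀ : 0 ≤ l₀)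
    (hg₀ : 0 ≤ g₀) {a q : ℕ → ℝ} (ha : ∀ n, 0 ≤ a n)
    (hrec : ∀ n ≤ N, a n ≤ x + ∑ k ∈ range n,
      (T / N * f₀ + 1 + c * (T / N) * l₀ + (T / N * K + c * (T / N) * K) * a k) + q n)
    (hq : ∀ n, q n ^ 2 ≤ ∑ k ∈ range n, p ^ 2 * m * (T / N) * (g₀ + K * a k) ^ 2) :
    ∀ n ≤ N, a n ≤ 2 * Real.exp (2 * (K ^ 2 * c ^ 2 * T + p ^ 2 * m * K ^ 2 + K ^ 2 * T) * T)
      * (x + N + (T * f₀ + T * c * l₀ + p * √(T * m) * g₀)) := by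
  set h := T / N with hh
  have hN' : (0 : ℝ) < N := by exact_mod_cast hN
  have hh0 : 0 < h := by positivity
  have hNh : N * h = T := by rw [hh]; field_simp
  set A := x + N + (T * f₀ + T * c * l₀ + p * √(T * m) * g₀) with hA
  have hA0 : 0 ≤ A := by positivity
  set κ := K ^ 2 * c ^ 2 * T + p ^ 2 * m * K ^ 2 + K ^ 2 * T with hκ
  have hκ0 : 0 ≤ κ := by positivity
  have hsq : ∀ n ≤ N, a n ^ 2 ≤ 4 * A ^ 2 + 4 * κ * h * ∑ k ∈ range n, a k ^ 2 := by
    intro n hn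
    have hnN : (n : ℝ) ≤ N := by exact_mod_cast hn
    have hnh : n * h ≤ T := hNh ▸ mul_le_mul_of_nonneg_right hnN hh0.le
    set S := ∑ k ∈ range n, a k ^ 2 with hS
    set Z := ∑ k ∈ range n, a k with hZ
    have hS0 : 0 ≤ S := sum_nonneg fun _ _ => sq_nonneg _
    have hZ0 : 0 ≤ Z := sum_nonneg fun k _ => ha k
    have hCS : Z ^ 2 ≤ n * S := by simpa using sq_sum_le_card_mul_sum_sq (s := range n) (f := a)
    have hZ1 : Z ≤ √n * √S := by
      rw [← Real.sqrt_mul (by positivity)]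
      exact Real.le_sqrt_of_sq_le hCS
    have hquad : ∑ k ∈ range n, p ^ 2 * m * h * (g₀ + K * a k) ^ 2
        = p ^ 2 * m * h * (n * g₀ ^ 2 + 2 * g₀ * K * Z + K ^ 2 * S) := by
      have e : ∀ k, (g₀ + K * a k) ^ 2 = g₀ ^ 2 + 2 * g₀ * K * a k + K ^ 2 * a k ^ 2 :=
        fun k => by ring
      simp_rw [← mul_sum, e, sum_add_distrib, ← mul_sum, sum_const, card_range, nsmul_eq_mul, hZ, hS]
    have hqn : q n ≤ p * √(T * m) * g₀ + p * K * √(m * h * S) := by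
      have h1 : n * g₀ ^ 2 + 2 * g₀ * K * Z + K ^ 2 * S ≤ (√n * g₀ + K * √S) ^ 2 := by
        have e1 : √(n : ℝ) ^ 2 = n := Real.sq_sqrt (by positivity)
        have e2 : √S ^ 2 = S := Real.sq_sqrt hS0
        have e3 : 2 * g₀ * K * Z ≤ 2 * g₀ * K * (√n * √S) := by gcongr
        calc _ ≤ √(n : ℝ) ^ 2 * g₀ ^ 2 + 2 * g₀ * K * (√n * √S) + K ^ 2 * √S ^ 2 := by
              rw [e1, e2]; linarith
          _ = _ := by ring
      have h2 : q n ^ 2 ≤ (p * √(m * h) * (√n * g₀ + K * √S)) ^ 2 := by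
        refine (hq n).trans ?_
        rw [hquad, mul_pow, mul_pow, Real.sq_sqrt (by positivity), ← mul_assoc (p ^ 2)]
        gcongr
      refine (abs_le_of_sq_le_sq' h2 (by positivity)).2.trans ?_
      have e1 : √(m * h) * √n ≤ √(T * m) := by
        rw [← Real.sqrt_mul (by positivity)]
        refine Real.sqrt_le_sqrt ?_
        calc (m * h * n : ℝ) = m * (n * h) := by ring
          _ ≤ m * T := by gcongr
          _ = T * m := by ring
      have e2 : √(m * h * S) = √(m * h) * √S := Real.sqrt_mul (by positivity) _
      rw [e2]
      have e3 : p * (√(m * h) * √n) * g₀ ≤ p * √(T * m) * g₀ := by gcongr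
      linarith
    have hdrift : ∑ k ∈ range n, (h * f₀ + 1 + c * h * l₀ + (h * K + c * h * K) * a k)
        ≤ T * f₀ + N + T * c * l₀ + K * h * Z + c * K * h * Z := by
      rw [sum_add_distrib, ← mul_sum, sum_const, card_range, nsmul_eq_mul, ← hZ]
      have e1 : n * h * f₀ ≤ T * f₀ := by gcongr
      have e2 : n * h * (c * l₀) ≤ T * (c * l₀) := by gcongr
      linarith
    have htot : a n ≤ A + K * h * Z + c * K * h * Z + p * K * √(m * h * S) := by
      have := hrec n hn
      linarith
    have hw : √(m * h * S) ^ 2 = m * h * S := Real.sq_sqrt (by positivity)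
    set w := √(m * h * S)
    have hw0 : 0 ≤ w := Real.sqrt_nonneg _
    have hhZ : (h * Z) ^ 2 ≤ T * h * S := by
      calc (h * Z) ^ 2 = h ^ 2 * Z ^ 2 := by ring
        _ ≤ h ^ 2 * (n * S) := by gcongr
        _ = (n * h) * h * S := by ring
        _ ≤ T * h * S := by gcongr
    calc a n ^ 2 ≤ (A + K * h * Z + c * K * h * Z + p * K * w) ^ 2 :=
          pow_le_pow_left₀ (ha n) htot 2
      _ ≤ 4 * (A ^ 2 + (K * h * Z) ^ 2 + (c * K * h * Z) ^ 2 + (p * K * w) ^ 2) :=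
          add_four_sq_le _ _ _ _
      _ = 4 * (A ^ 2 + K ^ 2 * (1 + c ^ 2) * (h * Z) ^ 2 + p ^ 2 * K ^ 2 * w ^ 2) := by ring
      _ ≤ 4 * (A ^ 2 + K ^ 2 * (1 + c ^ 2) * (T * h * S) + p ^ 2 * K ^ 2 * (m * h * S)) := by
          rw [hw]; gcongr
      _ = _ := by rw [hκ]; ring
  intro n hn
  have hnN : (n : ℝ) ≤ N := by exact_mod_cast hn
  have hg := le_mul_one_add_pow_of_le_add_sum (by positivity) hsq n hn
  have hexp : (1 + 4 * κ * h) ^ n ≤ Real.exp (2 * κ * T) ^ 2 := by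
    calc (1 + 4 * κ * h) ^ n ≤ Real.exp (4 * κ * h) ^ n := by
          gcongr
          linarith [Real.add_one_le_exp (4 * κ * h)]
      _ = Real.exp (n * (4 * κ * h)) := (Real.exp_nat_mul _ _).symm
      _ ≤ Real.exp ((2 : ℕ) * (2 * κ * T)) := by
          refine Real.exp_le_exp.2 ?_
          have : n * h ≤ T := hNh ▸ mul_le_mul_of_nonneg_right hnN hh0.le
          have := mul_le_mul_of_nonneg_left this (by positivity : 0 ≤ 4 * κ)
          push_cast
          linarith
      _ = _ := Real.exp_nat_mul _ _
  have : a n ^ 2 ≤ (2 * Real.exp (2 * κ * T) * A) ^ 2 := by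
    calc a n ^ 2 ≤ 4 * A ^ 2 * (1 + 4 * κ * h) ^ n := hg
      _ ≤ 4 * A ^ 2 * Real.exp (2 * κ * T) ^ 2 := by gcongr
      _ = _ := by ring
  exact (abs_le_of_sq_le_sq' this (by positivity)).2

/-- Moments of the coordinates of a centred Gaussian vector with covariance `h • 1`. -/
lemma eLpNorm_coord_le {m : ℕ} {h q : ℝ} (hh : 0 < h) (hq : 2 ≤ q) {W : Ω → Vec m}
    (hW : Measurable W)
    (hlaw : Measure.map W P = Measure.map (WithLp.toLp 2)
      (Measure.pi (fun _ : Fin m => gaussianReal 0 h.toNNReal))) (j : Fin m) :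
    eLpNorm (fun ω => W ω j) (ENNReal.ofReal q) P ≤ ENNReal.ofReal (√(q * h)) := by
  have hmap : Measure.map (fun ω => W ω j) P = gaussianReal 0 h.toNNReal := by
    have e : (fun ω => W ω j) = (fun v : Vec m => v j) ∘ W := rfl
    rw [e, ← Measure.map_map (by fun_prop) hW, hlaw, Measure.map_map (by fun_prop) (by fun_prop)]
    exact (measurePreserving_eval (fun _ : Fin m => gaussianReal 0 h.toNNReal) j).map_eq
  have hWj : Measurable (fun ω => W ω j) := by fun_prop
  have h1 := eLpNorm_map_measure (μ := P) (p := ENNReal.ofReal q) (g := fun x : ℝ => x)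
    (f := fun ω => W ω j) (by fun_prop) hWj.aemeasurable
  rw [hmap] at h1
  exact (h1.symm.le).trans (eLpNorm_gaussianReal_le hq hh)

lemma map_neg_eq_of_gaussian {m : ℕ} {h : ℝ} {W : Ω → Vec m} (hW : Measurable W)
    (hlaw : Measure.map W P = Measure.map (WithLp.toLp 2)
      (Measure.pi (fun _ : Fin m => gaussianReal 0 h.toNNReal))) :
    Measure.map (fun ω => -W ω) P = Measure.map W P := by
  have e : (fun ω => -W ω) = (fun v : Vec m => -v) ∘ W := rfl
  rw [e, ← Measure.map_map (by fun_prop) hW, hlaw, Measure.map_map (by fun_prop) (by fun_prop)]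
  have e2 : (fun v : Vec m => -v) ∘ WithLp.toLp 2
      = WithLp.toLp 2 ∘ (fun (v : Fin m → ℝ) i => (fun x : ℝ => -x) (v i)) := by
    ext v i; simp
  rw [e2, ← Measure.map_map (by fun_prop) (by fun_prop),
    Measure.pi_map_pi (fun i => by fun_prop)]
  simp only [gaussianReal_map_neg, neg_zero]

lemma eLpNorm_sq_le_of_gaussian {m : ℕ} {h p : ℝ} (hh : 0 < h) (hp : 2 ≤ p) {W : Ω → Vec m}
    (hW : Measurable W)
    (hlaw : Measure.map W P = Measure.map (WithLp.toLp 2)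
      (Measure.pi (fun _ : Fin m => gaussianReal 0 h.toNNReal))) :
    eLpNorm W (ENNReal.ofReal p) P ^ 2 ≤ ENNReal.ofReal (m * (p * h)) := by
  have h1 := eLpNorm_norm_sq (P := P) (p := p / 2) (by positivity) W
  rw [mul_div_cancel₀ _ two_ne_zero] at h1
  have h2 : (fun ω => ‖W ω‖ ^ 2) = ∑ j, (fun ω => ‖W ω j‖ ^ 2) := by
    ext ω; simp [EuclideanSpace.norm_sq_eq]
  rw [← h1, h2]
  refine (eLpNorm_sum_le (fun j _ => ?_) ?_).trans ?_
  · exact (by fun_prop : Measurable (fun ω => ‖W ω j‖ ^ 2)).aestronglyMeasurable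
  · rw [← ENNReal.ofReal_one]; exact ENNReal.ofReal_le_ofReal (by linarith)
  · have h3 : ∀ j ∈ Finset.univ, eLpNorm (fun ω => ‖W ω j‖ ^ 2) (ENNReal.ofReal (p / 2)) P
        ≤ ENNReal.ofReal (p * h) := by
      intro j _
      rw [eLpNorm_norm_sq (by positivity), mul_div_cancel₀ _ two_ne_zero]
      refine (pow_le_pow_left' (eLpNorm_coord_le hh hp hW hlaw j) 2).trans ?_
      rw [← ENNReal.ofReal_pow (by positivity), Real.sq_sqrt (by positivity)]
    refine (Finset.sum_le_card_nsmul _ _ _ h3).trans ?_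
    simp [ENNReal.ofReal_mul]

lemma eLpNorm_coord_mul_coord_sub_le [IsProbabilityMeasure P] {m : ℕ} {h p : ℝ} (hh : 0 < h)
    (hp : 2 ≤ p) {W : Ω → Vec m} (hW : Measurable W)
    (hlaw : Measure.map W P = Measure.map (WithLp.toLp 2)
      (Measure.pi (fun _ : Fin m => gaussianReal 0 h.toNNReal))) (i j : Fin m) :
    eLpNorm (fun ω => W ω i * W ω j - (if i = j then h else 0)) (ENNReal.ofReal p) P
      ≤ ENNReal.ofReal (p ^ 2 * h + if i = j then 3 * p ^ 2 * h + h else 0) := by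
  have hp0 : 0 < p := by linarith
  have hp1 : 1 ≤ ENNReal.ofReal p := by
    rw [← ENNReal.ofReal_one]; exact ENNReal.ofReal_le_ofReal (by linarith)
  have hsq : ∀ k, eLpNorm (fun ω => ‖W ω k‖ ^ 2) (ENNReal.ofReal p) P
      ≤ ENNReal.ofReal (2 * p * h) := by
    intro k
    rw [eLpNorm_norm_sq (by positivity)]
    refine (pow_le_pow_left' (eLpNorm_coord_le hh (by linarith) hW hlaw k) 2).trans ?_
    rw [← ENNReal.ofReal_pow (by positivity), Real.sq_sqrt (by positivity)]
  have hprod : eLpNorm (fun ω => W ω i * W ω j) (ENNReal.ofReal p) P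
      ≤ ENNReal.ofReal (2 * p * h) := by
    have h1 : eLpNorm (fun ω => W ω i * W ω j) (ENNReal.ofReal p) P
        ≤ ENNReal.ofReal (1 / 2)
          * eLpNorm (fun ω => ‖W ω i‖ ^ 2 + ‖W ω j‖ ^ 2) (ENNReal.ofReal p) P := by
      refine eLpNorm_le_mul_eLpNorm_of_ae_le_mul (Filter.Eventually.of_forall fun ω => ?_) _
      rw [norm_mul, Real.norm_of_nonneg (by positivity : 0 ≤ ‖W ω i‖ ^ 2 + ‖W ω j‖ ^ 2)]
      linarith [sq_nonneg (‖W ω i‖ - ‖W ω j‖)]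
    refine h1.trans ?_
    have h2 := (eLpNorm_add_le (μ := P) (p := ENNReal.ofReal p) (f := fun ω => ‖W ω i‖ ^ 2)
      (g := fun ω => ‖W ω j‖ ^ 2) (by fun_prop) (by fun_prop) hp1).trans
      (add_le_add (hsq i) (hsq j))
    refine (mul_le_mul_right h2 _).trans ?_
    rw [← ENNReal.ofReal_add (by positivity) (by positivity), ← ENNReal.ofReal_mul (by positivity)]
    exact ENNReal.ofReal_le_ofReal (by linarith)
  have hpp : 2 * p * h ≤ p ^ 2 * h := by nlinarith [mul_nonneg hp0.le hh.le]
  split_ifs with hij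
  · refine (eLpNorm_sub_le (f := fun ω => W ω i * W ω j) (g := fun _ => h) (by fun_prop)
      (by fun_prop) hp1).trans ?_
    rw [eLpNorm_const' _ (by simpa using hp0) ENNReal.ofReal_ne_top]
    simp only [measure_univ, ENNReal.one_rpow, mul_one]
    rw [← ofReal_norm, Real.norm_of_nonneg hh.le]
    refine (add_le_add hprod le_rfl).trans ?_
    rw [← ENNReal.ofReal_add (by positivity) hh.le]
    exact ENNReal.ofReal_le_ofReal (by linarith [mul_nonneg (sq_nonneg p) hh.le])
  · simp only [sub_zero, add_zero]
    exact hprod.trans (ENNReal.ofReal_le_ofReal hpp)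

lemma eLpNorm_comp_neg_eq_of_indepFun {α β E : Type*} [MeasurableSpace α] [MeasurableSpace β]
    [Neg β] [MeasurableNeg β] [NormedAddCommGroup E] [MeasurableSpace E] [BorelSpace E]
    [SecondCountableTopology E] [IsProbabilityMeasure P] {X : Ω → α} {W : Ω → β}
    (hX : Measurable X) (hW : Measurable W) (hXW : IndepFun X W P)
    (hneg : Measure.map (fun ω => -W ω) P = Measure.map W P) {Φ : α × β → E} (hΦ : Measurable Φ)
    (q : ℝ≥0∞) :
    eLpNorm (fun ω => Φ (X ω, -W ω)) q P = eLpNorm (fun ω => Φ (X ω, W ω)) q P := by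
  have hXW' : IndepFun X (fun ω => -W ω) P := hXW.comp measurable_id measurable_neg
  rw [indepFun_iff_map_prod_eq_prod_map_map (by fun_prop) (by fun_prop)] at hXW hXW'
  have h1 := eLpNorm_map_measure (μ := P) (p := q) (g := Φ) (f := fun ω => (X ω, W ω))
    hΦ.aestronglyMeasurable (by fun_prop)
  have h2 := eLpNorm_map_measure (μ := P) (p := q) (g := Φ) (f := fun ω => (X ω, -W ω))
    hΦ.aestronglyMeasurable (by fun_prop)
  rw [hXW', hneg, ← hXW] at h2
  exact h2.symm.trans h1

lemma eLpNorm_comp_le_of_linear_growth [NormedAddCommGroup E] [NormedAddCommGroup F]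
    [IsProbabilityMeasure P] {q : ℝ≥0∞} (hq : 1 ≤ q) {Φ : E → F} {a K : ℝ} (ha : 0 ≤ a)
    (hΦ : ∀ x, ‖Φ x‖ ≤ a + K * ‖x‖) (hK : 0 ≤ K) {Y : Ω → E} (hY : AEStronglyMeasurable Y P) :
    eLpNorm (fun ω => Φ (Y ω)) q P ≤ ENNReal.ofReal a + ENNReal.ofReal K * eLpNorm Y q P := by
  have h1 : eLpNorm (fun ω => Φ (Y ω)) q P ≤ eLpNorm (fun ω => a + K * ‖Y ω‖) q P :=
    eLpNorm_mono_real fun ω => hΦ (Y ω)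
  refine h1.trans ((eLpNorm_add_le (f := fun _ => a) (g := fun ω => K * ‖Y ω‖) (by fun_prop)
    (hY.norm.const_mul K) hq).trans (add_le_add ?_ ?_))
  · refine (eLpNorm_le_of_ae_bound (C := a) (Filter.Eventually.of_forall fun ω => ?_)).trans ?_
    · rw [Real.norm_of_nonneg ha]
    · simp
  · refine eLpNorm_le_mul_eLpNorm_of_ae_le_mul (Filter.Eventually.of_forall fun ω => ?_) _
    rw [norm_mul, Real.norm_of_nonneg hK, norm_norm]

lemma continuous_of_norm_sub_le [NormedAddCommGroup E] [NormedAddCommGroup F] {Φ : E → F} {K : ℝ}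
    (hK : 0 ≤ K) (hΦ : ∀ x y, ‖Φ x - Φ y‖ ≤ K * ‖x - y‖) : Continuous Φ := by
  lift K to ℝ≥0 using hK
  exact (LipschitzWith.of_dist_le_mul fun x y => by simpa [dist_eq_norm] using hΦ x y).continuous

lemma norm_le_add_mul_of_norm_sub_le [NormedAddCommGroup E] [NormedAddCommGroup F] {Φ : E → F}
    {K : ℝ} (hΦ : ∀ x y, ‖Φ x - Φ y‖ ≤ K * ‖x - y‖) (x : E) : ‖Φ x‖ ≤ ‖Φ 0‖ + K * ‖x‖ := by
  have h1 := hΦ x 0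
  have h2 := norm_sub_norm_le (Φ x) (Φ 0)
  rw [sub_zero] at h1
  linarith

/-- The part of the increment of `milstep` other than the Gaussian term `Gclm g y w`. -/
def milstepDrift {d m : ℕ} (h : ℝ) (ph ps : Vec d → Vec d) (g : Fin m → Vec d → Vec d)
    (y : Vec d) (w : Vec m) : Vec d :=
  h • ph y + (h / (1 + ‖ps y‖ * h)) • ps y
    + (2⁻¹ : ℝ) • ∑ j₁, ∑ j₂, (w j₁ * w j₂ - (if j₁ = j₂ then h else 0)) • Lg g j₁ j₂ y

lemma milstep_eq {d m : ℕ} (h : ℝ) (ph ps : Vec d → Vec d) (g : Fin m → Vec d → Vec d)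
    (y : Vec d) (w : Vec m) :
    milstep h ph ps g y w = y + milstepDrift h ph ps g y w + Gclm g y w := by
  simp only [milstep, milstepDrift]; abel

lemma continuous_Gclm_apply {d m : ℕ} {g : Fin m → Vec d → Vec d} (hg : Continuous (Gclm g)) :
    Continuous (fun z : Vec d × Vec m => Gclm g z.1 z.2) :=
  (hg.comp continuous_fst).clm_apply continuous_snd

lemma continuous_milstepDrift {d m : ℕ} {h : ℝ} (hh : 0 ≤ h) {ph ps : Vec d → Vec d}
    {g : Fin m → Vec d → Vec d} (hph : Continuous ph) (hps : Continuous ps)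
    (hL : ∀ j₁ j₂, Continuous (Lg g j₁ j₂)) :
    Continuous (fun z : Vec d × Vec m => milstepDrift h ph ps g z.1 z.2) := by
  have hpos : ∀ z : Vec d × Vec m, 1 + ‖ps z.1‖ * h ≠ 0 := fun z => by positivity
  have hLc : ∀ j₁ j₂, Continuous (fun z : Vec d × Vec m => Lg g j₁ j₂ z.1) :=
    fun j₁ j₂ => (hL j₁ j₂).comp continuous_fst
  unfold milstepDrift
  refine ((by fun_prop : Continuous fun z : Vec d × Vec m => h • ph z.1).add
    ((continuous_const.div (by fun_prop) hpos).smul (by fun_prop))).add ?_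
  have hterm : ∀ j₁ j₂, Continuous (fun z : Vec d × Vec m =>
      (z.2 j₁ * z.2 j₂ - (if j₁ = j₂ then h else 0)) • Lg g j₁ j₂ z.1) := fun j₁ j₂ =>
    (by fun_prop : Continuous fun z : Vec d × Vec m =>
      z.2 j₁ * z.2 j₂ - (if j₁ = j₂ then h else 0)).smul (hLc j₁ j₂)
  exact (continuous_finsetSum _ fun j₁ _ => continuous_finsetSum _ fun j₂ _ =>
    hterm j₁ j₂).const_smul (2⁻¹ : ℝ)

lemma norm_tamed_le_one [NormedAddCommGroup E] [NormedSpace ℝ E] {h : ℝ} (hh : 0 ≤ h) (v : E) :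
    ‖(h / (1 + ‖v‖ * h)) • v‖ ≤ 1 := by
  have : 0 < 1 + ‖v‖ * h := by positivity
  rw [norm_smul, Real.norm_of_nonneg (by positivity), div_mul_eq_mul_div, div_le_one this]
  linarith

/-- The moments of the Gaussian term of one step. -/
lemma eLpNorm_Gclm_apply_sq_le [IsProbabilityMeasure P] {d m : ℕ} {h p K : ℝ} (hh : 0 < h)
    (hp : 2 ≤ p) (hK : 0 ≤ K) {g : Fin m → Vec d → Vec d}
    (hgLip : ∀ x y : Vec d, ‖Gclm g x - Gclm g y‖ ≤ K * ‖x - y‖) {Y : Ω → Vec d} {W : Ω → Vec m}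
    (hY : Measurable Y) (hW : Measurable W)
    (hlaw : Measure.map W P = Measure.map (WithLp.toLp 2)
      (Measure.pi (fun _ : Fin m => gaussianReal 0 h.toNNReal))) (hYW : IndepFun Y W P) :
    eLpNorm (fun ω => Gclm g (Y ω) (W ω)) (ENNReal.ofReal p) P ^ 2
      ≤ ENNReal.ofReal (m * (p * h)) * (ENNReal.ofReal ‖Gclm g 0‖
        + ENNReal.ofReal K * eLpNorm Y (ENNReal.ofReal p) P) ^ 2 := by
  have hp1 : 1 ≤ ENNReal.ofReal p := by
    rw [← ENNReal.ofReal_one]; exact ENNReal.ofReal_le_ofReal (by linarith)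
  have hGc := continuous_of_norm_sub_le hK hgLip
  have hGn : Measurable (fun y => ‖Gclm g y‖) := hGc.norm.measurable
  have hind : IndepFun (fun ω => ‖W ω‖) (fun ω => ‖Gclm g (Y ω)‖) P :=
    (hYW.comp hGn measurable_norm).symm
  have h1 : eLpNorm (fun ω => Gclm g (Y ω) (W ω)) (ENNReal.ofReal p) P
      ≤ eLpNorm W (ENNReal.ofReal p) P
        * eLpNorm (fun ω => Gclm g (Y ω)) (ENNReal.ofReal p) P := by
    rw [← eLpNorm_norm W, ← eLpNorm_norm (fun ω => Gclm g (Y ω)),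
      ← eLpNorm_smul_of_indepFun (b := fun ω => ‖Gclm g (Y ω)‖) (by linarith : 0 < p)
        (by fun_prop) (hGn.comp hY) hind]
    refine eLpNorm_mono_real fun ω => ?_
    rw [smul_eq_mul, mul_comm]
    exact (Gclm g (Y ω)).le_opNorm (W ω)
  refine (pow_le_pow_left' h1 2).trans ?_
  rw [mul_pow]
  refine mul_le_mul' (eLpNorm_sq_le_of_gaussian hh hp hW hlaw) (pow_le_pow_left' ?_ 2)
  exact eLpNorm_comp_le_of_linear_growth hp1 (norm_nonneg _)
    (norm_le_add_mul_of_norm_sub_le hgLip) hK hY.aestronglyMeasurable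

lemma eLpNorm_milstepDrift_le [IsProbabilityMeasure P] {d m : ℕ} {h p K : ℝ} (hh : 0 < h)
    (hp : 2 ≤ p) (hK : 0 ≤ K) {ph ps : Vec d → Vec d} {g : Fin m → Vec d → Vec d}
    (hphLip : ∀ x y : Vec d, ‖ph x - ph y‖ ≤ K * ‖x - y‖) (hps : Continuous ps)
    (hLgLip : ∀ (j₁ j₂ : Fin m) (x y : Vec d), ‖Lg g j₁ j₂ x - Lg g j₁ j₂ y‖ ≤ K * ‖x - y‖)
    {Y : Ω → Vec d} {W : Ω → Vec m} (hY : Measurable Y) (hW : Measurable W)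
    (hlaw : Measure.map W P = Measure.map (WithLp.toLp 2)
      (Measure.pi (fun _ : Fin m => gaussianReal 0 h.toNNReal))) (hYW : IndepFun Y W P)
    {c L₀ : ℝ} (hc : c = ((m : ℝ) ^ 2 - m) / 2 * p ^ 2 + 2 * m * p ^ 2 + m / 2) (hL₀ : 0 ≤ L₀)
    (hL : ∀ j₁ j₂, ‖Lg g j₁ j₂ 0‖ ≤ L₀) :
    eLpNorm (fun ω => milstepDrift h ph ps g (Y ω) (W ω)) (ENNReal.ofReal p) P
      ≤ ENNReal.ofReal (h * ‖ph 0‖ + 1 + c * h * L₀)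
        + ENNReal.ofReal (h * K + c * h * K) * eLpNorm Y (ENNReal.ofReal p) P := by
  have hp1 : 1 ≤ ENNReal.ofReal p := by
    rw [← ENNReal.ofReal_one]; exact ENNReal.ofReal_le_ofReal (by linarith)
  set q := ENNReal.ofReal p
  set y := eLpNorm Y q P with hy
  have hLc : ∀ j₁ j₂, Continuous (Lg g j₁ j₂) := fun j₁ j₂ =>
    continuous_of_norm_sub_le hK (hLgLip j₁ j₂)
  have hphc : Continuous ph := continuous_of_norm_sub_le hK hphLip
  have hYs : AEStronglyMeasurable Y P := hY.aestronglyMeasurable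
  have hph : eLpNorm (fun ω => h • ph (Y ω)) q P
      ≤ ENNReal.ofReal (h * ‖ph 0‖) + ENNReal.ofReal (h * K) * y := by
    refine eLpNorm_comp_le_of_linear_growth (Φ := fun x => h • ph x) hp1 (by positivity)
      (fun x => ?_) (by positivity) hYs
    rw [norm_smul, Real.norm_of_nonneg hh.le, mul_assoc, ← mul_add]
    exact mul_le_mul_of_nonneg_left (norm_le_add_mul_of_norm_sub_le hphLip x) hh.le
  have hpsb : eLpNorm (fun ω => (h / (1 + ‖ps (Y ω)‖ * h)) • ps (Y ω)) q P ≤ ENNReal.ofReal 1 := by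
    refine (eLpNorm_le_of_ae_bound (C := 1)
      (Filter.Eventually.of_forall fun ω => norm_tamed_le_one hh.le _)).trans ?_
    simp
  set b : Fin m → Fin m → ℝ := fun i j => p ^ 2 * h + if i = j then 3 * p ^ 2 * h + h else 0
    with hb
  have hb0 : ∀ i j, 0 ≤ b i j := fun i j => by simp only [hb]; split_ifs <;> positivity
  have hterm : ∀ i j, eLpNorm (fun ω => (W ω i * W ω j - (if i = j then h else 0))
      • Lg g i j (Y ω)) q P ≤ ENNReal.ofReal (b i j) * (ENNReal.ofReal L₀ + ENNReal.ofReal K * y) := by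
    intro i j
    have hcoef : Measurable (fun w : Vec m => w i * w j - (if i = j then h else 0)) := by fun_prop
    have hind : IndepFun (fun ω => W ω i * W ω j - (if i = j then h else 0))
        (fun ω => Lg g i j (Y ω)) P := (hYW.comp (hLc i j).measurable hcoef).symm
    rw [eLpNorm_smul_of_indepFun (a := fun ω => W ω i * W ω j - (if i = j then h else 0))
      (b := fun ω => Lg g i j (Y ω)) (by linarith : 0 < p) (hcoef.comp hW)
      ((hLc i j).measurable.comp hY) hind]
    refine mul_le_mul' (eLpNorm_coord_mul_coord_sub_le hh hp hW hlaw i j)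
      (eLpNorm_comp_le_of_linear_growth hp1 hL₀ (fun x => ?_) hK hYs)
    exact (norm_le_add_mul_of_norm_sub_le (hLgLip i j) x).trans (by gcongr; exact hL i j)
  have htermm : ∀ i j, Measurable (fun ω => (W ω i * W ω j - (if i = j then h else 0))
      • Lg g i j (Y ω)) := fun i j =>
    (by fun_prop : Measurable fun ω => W ω i * W ω j - (if i = j then h else 0)).smul
      ((hLc i j).measurable.comp hY)
  have hsum : eLpNorm (fun ω => (2⁻¹ : ℝ) • ∑ i, ∑ j,
      (W ω i * W ω j - (if i = j then h else 0)) • Lg g i j (Y ω)) q P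
      ≤ ENNReal.ofReal (c * h) * (ENNReal.ofReal L₀ + ENNReal.ofReal K * y) := by
    have e : (fun ω => (2⁻¹ : ℝ) • ∑ i, ∑ j,
        (W ω i * W ω j - (if i = j then h else 0)) • Lg g i j (Y ω))
        = (2⁻¹ : ℝ) • ∑ i, ∑ j, (fun ω =>
          (W ω i * W ω j - (if i = j then h else 0)) • Lg g i j (Y ω)) := by
      ext1 ω; simp only [Pi.smul_apply, Finset.sum_apply]
    rw [e, eLpNorm_const_smul]
    have h2 : eLpNorm (∑ i, ∑ j, (fun ω =>
        (W ω i * W ω j - (if i = j then h else 0)) • Lg g i j (Y ω))) q P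
        ≤ ∑ i, ∑ j, ENNReal.ofReal (b i j) * (ENNReal.ofReal L₀ + ENNReal.ofReal K * y) := by
      refine (eLpNorm_sum_le (fun i _ => ?_) hp1).trans (Finset.sum_le_sum fun i _ => ?_)
      · exact Finset.aestronglyMeasurable_sum _ fun j _ => (htermm i j).aestronglyMeasurable
      · exact (eLpNorm_sum_le (fun j _ => (htermm i j).aestronglyMeasurable) hp1).trans
          (Finset.sum_le_sum fun j _ => hterm i j)
    refine (mul_le_mul_right h2 _).trans (le_of_eq ?_)
    simp_rw [← Finset.sum_mul]
    rw [← mul_assoc]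
    congr 1
    simp_rw [← ENNReal.ofReal_sum_of_nonneg (fun j _ => hb0 _ j)]
    rw [← ENNReal.ofReal_sum_of_nonneg (fun i _ => Finset.sum_nonneg fun j _ => hb0 i j),
      ← ofReal_norm, ← ENNReal.ofReal_mul (norm_nonneg _)]
    congr 1
    simp only [hb, Finset.sum_add_distrib, Finset.sum_const, Finset.card_univ, Fintype.card_fin,
      nsmul_eq_mul, Finset.sum_ite_eq, Finset.mem_univ, if_true]
    rw [hc]; norm_num; ring
  have hc0 : 0 ≤ c := by
    have : (0 : ℝ) ≤ m := by positivity
    have h3 : c = (m : ℝ) ^ 2 / 2 * p ^ 2 + 3 / 2 * m * p ^ 2 + m / 2 := by rw [hc]; ring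
    rw [h3]; positivity
  have hm1 : Measurable (fun ω => h • ph (Y ω)) := (hphc.measurable.comp hY).const_smul h
  have hm2 : Measurable (fun ω => (h / (1 + ‖ps (Y ω)‖ * h)) • ps (Y ω)) := by
    have := hps.measurable.comp hY
    simp only [Function.comp_def] at this
    fun_prop
  have hm3 : Measurable (fun ω => (2⁻¹ : ℝ) • ∑ i, ∑ j,
      (W ω i * W ω j - (if i = j then h else 0)) • Lg g i j (Y ω)) :=
    (Finset.measurable_fun_sum _ fun i _ =>
      Finset.measurable_fun_sum _ fun j _ => htermm i j).const_smul (2⁻¹ : ℝ)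
  have h12 := (eLpNorm_add_le hm1.aestronglyMeasurable hm2.aestronglyMeasurable hp1).trans
    (add_le_add hph hpsb)
  refine ((eLpNorm_add_le (hm1.add hm2).aestronglyMeasurable hm3.aestronglyMeasurable hp1).trans
    (add_le_add h12 hsum)).trans (le_of_eq ?_)
  rw [ENNReal.ofReal_add (by positivity) (by positivity),
    ENNReal.ofReal_add (by positivity) (by positivity),
    ENNReal.ofReal_add (by positivity) (by positivity), ENNReal.ofReal_mul (p := c * h) (by positivity),
    ENNReal.ofReal_mul (p := c * h) (by positivity)]
  ring

lemma measurable_Gclm_apply {α : Type*} [MeasurableSpace α] {d m : ℕ} {g : Fin m → Vec d → Vec d}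
    (hg : Continuous (Gclm g)) {y : α → Vec d} {w : α → Vec m} (hy : Measurable y)
    (hw : Measurable w) : Measurable (fun x => Gclm g (y x) (w x)) :=
  Measurable.comp (f := fun x => (y x, w x)) (continuous_Gclm_apply hg).measurable (hy.prodMk hw)

lemma measurable_milstepDrift {α : Type*} [MeasurableSpace α] {d m : ℕ} {h : ℝ} (hh : 0 ≤ h)
    {ph ps : Vec d → Vec d} {g : Fin m → Vec d → Vec d} (hph : Continuous ph)
    (hps : Continuous ps) (hL : ∀ j₁ j₂, Continuous (Lg g j₁ j₂)) {y : α → Vec d} {w : α → Vec m}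
    (hy : Measurable y) (hw : Measurable w) :
    Measurable (fun x => milstepDrift h ph ps g (y x) (w x)) :=
  Measurable.comp (f := fun x => (y x, w x)) (continuous_milstepDrift hh hph hps hL).measurable
    (hy.prodMk hw)

/-- The accumulated Gaussian terms of the scheme. -/
def gaussianPart {d m : ℕ} (g : Fin m → Vec d → Vec d) (Y : ℕ → Ω → Vec d) (W : ℕ → Ω → Vec m)
    (n : ℕ) (ω : Ω) : Vec d :=
  ∑ k ∈ range n, Gclm g (Y k ω) (W k ω)

lemma gaussianPart_succ {d m : ℕ} (g : Fin m → Vec d → Vec d) (Y : ℕ → Ω → Vec d)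
    (W : ℕ → Ω → Vec m) (n : ℕ) (ω : Ω) :
    gaussianPart g Y W (n + 1) ω = gaussianPart g Y W n ω + Gclm g (Y n ω) (W n ω) :=
  Finset.sum_range_succ _ _

/-- The state of a recursion driven by independent noise is independent of the future noise. -/
lemma indepFun_tail_of_rec {α β : Type*} [MeasurableSpace α] [MeasurableSpace β]
    [IsProbabilityMeasure P] {X : ℕ → Ω → α} {W : ℕ → Ω → β} {Ψ : α × β → α} (hΨ : Measurable Ψ)
    (hX : ∀ n, Measurable (X n)) (hW : ∀ k, Measurable (W k)) (hindep : iIndepFun W P)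
    (hX0 : IndepFun (X 0) (fun ω k => W k ω) P) (hrec : ∀ n ω, X (n + 1) ω = Ψ (X n ω, W n ω))
    (n : ℕ) : IndepFun (X n) (fun ω k => W (n + k) ω) P := by
  induction n with
  | zero => simpa using hX0
  | succ n ih =>
    have hsplit : Measurable (fun w : ℕ → β => (w 0, fun k => w (k + 1))) := by fun_prop
    have h1 : IndepFun (X n) (fun ω => (W n ω, fun k => W (n + 1 + k) ω)) P := by
      have := ih.comp measurable_id hsplit
      simpa only [Function.comp_def, id, add_zero, add_assoc, add_comm 1] using this
    have h2 := IndepFun.prodMk_left_of_prodMk_right (hX n) (hW n) (by fun_prop) h1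
      (iIndepFun.indepFun_tail hW hindep n)
    have e : X (n + 1) = Ψ ∘ fun ω => (X n ω, W n ω) := funext fun ω => hrec n ω
    rw [e]
    exact h2.comp hΨ measurable_id

section scheme

variable {d m : ℕ} {ph ps : Vec d → Vec d} {g : Fin m → Vec d → Vec d} {h p K : ℝ}
  {W : ℕ → Ω → Vec m} {Y : ℕ → Ω → Vec d}

lemma measurable_milstep_iterate (hh : 0 ≤ h) (hph : Continuous ph) (hps : Continuous ps)
    (hg : Continuous (Gclm g)) (hL : ∀ j₁ j₂, Continuous (Lg g j₁ j₂))
    (hY0 : Measurable (Y 0)) (hW : ∀ k, Measurable (W k))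
    (hYrec : ∀ n ω, Y (n + 1) ω = milstep h ph ps g (Y n ω) (W n ω)) (n : ℕ) :
    Measurable (Y n) := by
  induction n with
  | zero => exact hY0
  | succ n ih =>
    have e : Y (n + 1) = fun ω => Y n ω + milstepDrift h ph ps g (Y n ω) (W n ω)
        + Gclm g (Y n ω) (W n ω) := by
      ext1 ω; rw [hYrec, milstep_eq]
    rw [e]
    exact (ih.add (measurable_milstepDrift hh hph hps hL ih (hW n))).add
      (measurable_Gclm_apply hg ih (hW n))

lemma measurable_gaussianPart (hg : Continuous (Gclm g)) (hY : ∀ n, Measurable (Y n))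
    (hW : ∀ k, Measurable (W k)) (n : ℕ) : Measurable (gaussianPart g Y W n) :=
  Finset.measurable_fun_sum _ fun k _ => measurable_Gclm_apply hg (hY k) (hW k)

lemma indepFun_gaussianPart_prodMk [IsProbabilityMeasure P] (hh : 0 ≤ h) (hph : Continuous ph)
    (hps : Continuous ps) (hg : Continuous (Gclm g)) (hL : ∀ j₁ j₂, Continuous (Lg g j₁ j₂))
    (hY : ∀ n, Measurable (Y n)) (hW : ∀ k, Measurable (W k)) (hindep : iIndepFun W P)
    (hindep0 : IndepFun (Y 0) (fun ω k => W k ω) P)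
    (hYrec : ∀ n ω, Y (n + 1) ω = milstep h ph ps g (Y n ω) (W n ω)) (n : ℕ) :
    IndepFun (fun ω => (gaussianPart g Y W n ω, Y n ω)) (W n) P := by
  have hGm := measurable_Gclm_apply (α := (Vec d × Vec d) × Vec m) hg measurable_fst.snd
    measurable_snd
  have hDm := measurable_milstepDrift (α := (Vec d × Vec d) × Vec m) hh hph hps hL
    measurable_fst.snd measurable_snd
  have hΨ : Measurable (fun z : (Vec d × Vec d) × Vec m =>
      (z.1.1 + Gclm g z.1.2 z.2, z.1.2 + milstepDrift h ph ps g z.1.2 z.2 + Gclm g z.1.2 z.2)) :=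
    (measurable_fst.fst.add hGm).prodMk ((measurable_fst.snd.add hDm).add hGm)
  have h1 := indepFun_tail_of_rec (P := P) (X := fun n ω => (gaussianPart g Y W n ω, Y n ω)) hΨ
    (fun n => (measurable_gaussianPart hg hY hW n).prodMk (hY n)) hW hindep ?_ ?_ n
  · exact h1.comp measurable_id (measurable_pi_apply 0)
  · have e : (fun ω => (gaussianPart g Y W 0 ω, Y 0 ω)) = (fun y => ((0 : Vec d), y)) ∘ Y 0 := by
      ext1 ω; simp [gaussianPart]
    rw [e]
    exact hindep0.comp (by fun_prop) measurable_id
  · intro n ω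
    simp only [gaussianPart_succ, hYrec, milstep_eq]

lemma eLpNorm_gaussianPart_succ_sq_le [IsProbabilityMeasure P] (hh : 0 < h) (hp : 2 ≤ p)
    (hK : 0 ≤ K) (hgLip : ∀ x y : Vec d, ‖Gclm g x - Gclm g y‖ ≤ K * ‖x - y‖)
    (hY : ∀ n, Measurable (Y n)) (hW : ∀ k, Measurable (W k)) {n : ℕ}
    (hlaw : Measure.map (W n) P = Measure.map (WithLp.toLp 2)
      (Measure.pi (fun _ : Fin m => gaussianReal 0 h.toNNReal)))
    (hind : IndepFun (fun ω => (gaussianPart g Y W n ω, Y n ω)) (W n) P) :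
    eLpNorm (gaussianPart g Y W (n + 1)) (ENNReal.ofReal p) P ^ 2
      ≤ eLpNorm (gaussianPart g Y W n) (ENNReal.ofReal p) P ^ 2
        + ENNReal.ofReal (p ^ 2 * m * h) * (ENNReal.ofReal ‖Gclm g 0‖
          + ENNReal.ofReal K * eLpNorm (Y n) (ENNReal.ofReal p) P) ^ 2 := by
  have hg := continuous_of_norm_sub_le hK hgLip
  have hM := measurable_gaussianPart hg hY hW n
  have hV : Measurable (fun ω => Gclm g (Y n ω) (W n ω)) :=
    measurable_Gclm_apply hg (hY n) (hW n)
  have hΦ : Measurable (fun z : (Vec d × Vec d) × Vec m => z.1.1 + Gclm g z.1.2 z.2) :=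
    measurable_fst.fst.add (measurable_Gclm_apply hg measurable_fst.snd measurable_snd)
  have hsymm := eLpNorm_comp_neg_eq_of_indepFun (hM.prodMk (hY n)) (hW n) hind
    (map_neg_eq_of_gaussian (hW n) hlaw) hΦ (ENNReal.ofReal p)
  simp only [map_neg, ← sub_eq_add_neg] at hsymm
  have e : gaussianPart g Y W (n + 1)
      = fun ω => gaussianPart g Y W n ω + Gclm g (Y n ω) (W n ω) :=
    funext fun ω => gaussianPart_succ g Y W n ω
  rw [e]
  refine (eLpNorm_add_sq_le_of_symmetric hp hM hV hsymm).trans (add_le_add le_rfl ?_)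
  have hYW : IndepFun (Y n) (W n) P := hind.comp measurable_snd measurable_id
  refine (mul_le_mul_right (eLpNorm_Gclm_apply_sq_le hh hp hK hgLip (hY n) (hW n) hlaw hYW)
    _).trans ?_
  rw [← mul_assoc, ← ENNReal.ofReal_mul (by linarith)]
  refine mul_le_mul_left (ENNReal.ofReal_le_ofReal ?_) _
  have : 0 ≤ (m : ℝ) * (p * h) := by positivity
  linarith

lemma milstep_iterate_eq (hYrec : ∀ n ω, Y (n + 1) ω = milstep h ph ps g (Y n ω) (W n ω)) (n : ℕ) :
    Y n = Y 0 + ∑ k ∈ range n, (fun ω => milstepDrift h ph ps g (Y k ω) (W k ω))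
      + gaussianPart g Y W n := by
  induction n with
  | zero => ext1 ω; simp [gaussianPart]
  | succ n ih =>
    ext1 ω
    have hω := congrFun ih ω
    simp only [Pi.add_apply, Finset.sum_apply] at hω
    rw [hYrec, milstep_eq]
    simp only [Pi.add_apply, Finset.sum_apply, Finset.sum_range_succ, gaussianPart_succ]
    nth_rewrite 1 [hω]
    abel

end scheme

/-- A moment recursion started from finite data stays finite. -/
lemma ne_top_of_le_add_sum {a q : ℕ → ℝ≥0∞} {x r s u v w : ℝ≥0∞} (hx : x ≠ ⊤) (hr : r ≠ ⊤)
    (hs : s ≠ ⊤) (hu : u ≠ ⊤) (hv : v ≠ ⊤) (hw : w ≠ ⊤)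
    (ha : ∀ n, a n ≤ x + ∑ k ∈ range n, (r + s * a k) + q n)
    (hq : ∀ n, q n ^ 2 ≤ ∑ k ∈ range n, u * (v + w * a k) ^ 2) (n : ℕ) : a n ≠ ⊤ ∧ q n ≠ ⊤ := by
  induction n using Nat.strong_induction_on with
  | _ n ih =>
    have hqn : q n ≠ ⊤ := by
      have : q n ^ 2 ≠ ⊤ := ne_top_of_le_ne_top (ENNReal.sum_ne_top.2 fun k hk =>
        ENNReal.mul_ne_top hu (ENNReal.pow_ne_top (ENNReal.add_ne_top.2
          ⟨hv, ENNReal.mul_ne_top hw (ih k (Finset.mem_range.1 hk)).1⟩))) (hq n)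
      intro h
      simp [h] at this
    refine ⟨ne_top_of_le_ne_top (ENNReal.add_ne_top.2 ⟨ENNReal.add_ne_top.2
      ⟨hx, ENNReal.sum_ne_top.2 fun k hk => ENNReal.add_ne_top.2
        ⟨hr, ENNReal.mul_ne_top hs (ih k (Finset.mem_range.1 hk)).1⟩⟩, hqn⟩) (ha n), hqn⟩

lemma toReal_le_add_sum {a : ℕ → ℝ≥0∞} {x q : ℝ≥0∞} {r s : ℝ} {n : ℕ} (hr : 0 ≤ r) (hs : 0 ≤ s)
    (ha : ∀ k, a k ≠ ⊤) (hx : x ≠ ⊤) (hq : q ≠ ⊤)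
    (h : a n ≤ x + ∑ k ∈ range n, (ENNReal.ofReal r + ENNReal.ofReal s * a k) + q) :
    (a n).toReal ≤ x.toReal + ∑ k ∈ range n, (r + s * (a k).toReal) + q.toReal := by
  have hk : ∀ k ∈ range n, ENNReal.ofReal r + ENNReal.ofReal s * a k ≠ ⊤ := fun k _ =>
    ENNReal.add_ne_top.2 ⟨ENNReal.ofReal_ne_top, ENNReal.mul_ne_top ENNReal.ofReal_ne_top (ha k)⟩
  have hsum := ENNReal.sum_ne_top.2 hk
  have h1 := ENNReal.toReal_mono
    (ENNReal.add_ne_top.2 ⟨ENNReal.add_ne_top.2 ⟨hx, hsum⟩, hq⟩) h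
  rw [ENNReal.toReal_add (ENNReal.add_ne_top.2 ⟨hx, hsum⟩) hq, ENNReal.toReal_add hx hsum,
    ENNReal.toReal_sum hk] at h1
  refine h1.trans (le_of_eq ?_)
  congr 2
  refine Finset.sum_congr rfl fun k _ => ?_
  rw [ENNReal.toReal_add ENNReal.ofReal_ne_top
    (ENNReal.mul_ne_top ENNReal.ofReal_ne_top (ha k)), ENNReal.toReal_mul,
    ENNReal.toReal_ofReal hr, ENNReal.toReal_ofReal hs]

lemma toReal_sq_le_sum_sq {a : ℕ → ℝ≥0∞} {q : ℝ≥0∞} {u v w : ℝ} {n : ℕ} (hu : 0 ≤ u) (hv : 0 ≤ v)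
    (hw : 0 ≤ w) (ha : ∀ k, a k ≠ ⊤)
    (h : q ^ 2 ≤ ∑ k ∈ range n,
      ENNReal.ofReal u * (ENNReal.ofReal v + ENNReal.ofReal w * a k) ^ 2) :
    q.toReal ^ 2 ≤ ∑ k ∈ range n, u * (v + w * (a k).toReal) ^ 2 := by
  have hm : ∀ k, ENNReal.ofReal w * a k ≠ ⊤ := fun k =>
    ENNReal.mul_ne_top ENNReal.ofReal_ne_top (ha k)
  have hk : ∀ k ∈ range n,
      ENNReal.ofReal u * (ENNReal.ofReal v + ENNReal.ofReal w * a k) ^ 2 ≠ ⊤ := fun k _ =>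
    ENNReal.mul_ne_top ENNReal.ofReal_ne_top
      (ENNReal.pow_ne_top (ENNReal.add_ne_top.2 ⟨ENNReal.ofReal_ne_top, hm k⟩))
  have h1 := ENNReal.toReal_mono (ENNReal.sum_ne_top.2 hk) h
  rw [ENNReal.toReal_pow, ENNReal.toReal_sum hk] at h1
  refine h1.trans (le_of_eq (Finset.sum_congr rfl fun k _ => ?_))
  rw [ENNReal.toReal_mul, ENNReal.toReal_pow, ENNReal.toReal_add ENNReal.ofReal_ne_top (hm k),
    ENNReal.toReal_mul, ENNReal.toReal_ofReal hu, ENNReal.toReal_ofReal hv,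
    ENNReal.toReal_ofReal hw]

end

noncomputable section

/-- Inequality (2.38): an a priori L^p bound for the scheme with explicit constants. -/
theorem a_priori_Lp_bound_explicit
    (d m N : ℕ) (hd : 0 < d) (hm : 0 < m) (hN : 0 < N)
    (T K c : ℝ) (hT : 0 < T) (hK : 1 ≤ K) (hc : 1 ≤ c)
    (ph ps : Vec d → Vec d) (g : Fin m → Vec d → Vec d)
    (hgdiff : ∀ j, ContDiff ℝ 1 (g j))
    (hOSL : ∀ x y : Vec d, ⟪x - y, (ph x + ps x) - (ph y + ps y)⟫ ≤ K * ‖x - y‖ ^ 2)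
    (hgLip : ∀ x y : Vec d, ‖Gclm g x - Gclm g y‖ ≤ K * ‖x - y‖)
    (hphLip : ∀ x y : Vec d, ‖ph x - ph y‖ ≤ K * ‖x - y‖)
    (hpsC : ContDiff ℝ 1 ps)
    (hps' : ∀ x : Vec d, ‖fderiv ℝ ps x‖ ≤ K * ‖x‖ ^ c)
    (hLgLip : ∀ (j₁ j₂ : Fin m) (x y : Vec d), ‖Lg g j₁ j₂ x - Lg g j₁ j₂ y‖ ≤ K * ‖x - y‖)
    (p : ℝ) (hp : 2 ≤ p)
    (Ω : Type) (mΩ : MeasurableSpace Ω) (P : Measure Ω) (hP : IsProbabilityMeasure P)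
    (ξ : Ω → Vec d) (ΔW : ℕ → Ω → Vec m) (Y : ℕ → Ω → Vec d)
    (hξmeas : Measurable ξ) (hWmeas : ∀ k, Measurable (ΔW k))
    (hξLp : MemLp ξ (ENNReal.ofReal p) P)
    (hlaw : ∀ k, Measure.map (ΔW k) P
      = Measure.map (WithLp.toLp 2)
          (Measure.pi (fun _ : Fin m => gaussianReal 0 (Real.toNNReal (T / N)))))
    (hindep : iIndepFun ΔW P)
    (hindepξ : IndepFun ξ (fun ω k => ΔW k ω) P)
    (hY0 : ∀ ω, Y 0 ω = ξ ω)
    (hYrec : ∀ n ω, Y (n + 1) ω = milstep (T / N) ph ps g (Y n ω) (ΔW n ω)) :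
    ∀ n ≤ N, eLpNorm (Y n) (ENNReal.ofReal p) P
      ≤ ENNReal.ofReal (2 *
          Real.exp (2 * (K ^ 2 * (((m : ℝ) ^ 2 - m) / 2 * p ^ 2 + 2 * m * p ^ 2 + m / 2) ^ 2 * T
              + p ^ 2 * m * K ^ 2 + K ^ 2 * T) * T) *
          ((eLpNorm ξ (ENNReal.ofReal p) P).toReal + N
            + (T * ‖ph 0‖
              + T * (((m : ℝ) ^ 2 - m) / 2 * p ^ 2 + 2 * m * p ^ 2 + m / 2) *
                  (⨆ j : Fin m × Fin m, ‖Lg g j.1 j.2 0‖)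
              + p * Real.sqrt (T * m) * ‖Gclm g 0‖))) := by
  have hh : 0 < T / N := by positivity
  have hK0 : 0 ≤ K := by linarith
  have hp1 : 1 ≤ ENNReal.ofReal p := by
    rw [← ENNReal.ofReal_one]; exact ENNReal.ofReal_le_ofReal (by linarith)
  have hph := continuous_of_norm_sub_le hK0 hphLip
  have hg := continuous_of_norm_sub_le hK0 hgLip
  have hL : ∀ j₁ j₂, Continuous (Lg g j₁ j₂) := fun j₁ j₂ =>
    continuous_of_norm_sub_le hK0 (hLgLip j₁ j₂)
  obtain rfl : Y 0 = ξ := funext hY0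
  have hYm := measurable_milstep_iterate hh.le hph hpsC.continuous hg hL hξmeas hWmeas hYrec
  have hind := indepFun_gaussianPart_prodMk hh.le hph hpsC.continuous hg hL hYm hWmeas hindep
    hindepξ hYrec
  have hYW : ∀ n, IndepFun (Y n) (ΔW n) P := fun n => (hind n).comp measurable_snd measurable_id
  set c' : ℝ := ((m : ℝ) ^ 2 - m) / 2 * p ^ 2 + 2 * m * p ^ 2 + m / 2 with hc'
  set L₀ : ℝ := ⨆ j : Fin m × Fin m, ‖Lg g j.1 j.2 0‖ with hL₀
  have hL₀0 : 0 ≤ L₀ := Real.iSup_nonneg fun _ => norm_nonneg _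
  have hL₀le : ∀ j₁ j₂, ‖Lg g j₁ j₂ 0‖ ≤ L₀ := fun j₁ j₂ =>
    le_ciSup (f := fun j : Fin m × Fin m => ‖Lg g j.1 j.2 0‖) (Set.finite_range _).bddAbove (j₁, j₂)
  have hc'0 : 0 ≤ c' := by
    have h3 : c' = (m : ℝ) ^ 2 / 2 * p ^ 2 + 3 / 2 * m * p ^ 2 + m / 2 := by rw [hc']; ring
    rw [h3]; positivity
  set a : ℕ → ℝ≥0∞ := fun n => eLpNorm (Y n) (ENNReal.ofReal p) P with ha
  set q : ℕ → ℝ≥0∞ := fun n => eLpNorm (gaussianPart g Y ΔW n) (ENNReal.ofReal p) P with hq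
  have hdrift : ∀ k, eLpNorm (fun ω => milstepDrift (T / N) ph ps g (Y k ω) (ΔW k ω))
      (ENNReal.ofReal p) P ≤ ENNReal.ofReal (T / N * ‖ph 0‖ + 1 + c' * (T / N) * L₀)
        + ENNReal.ofReal (T / N * K + c' * (T / N) * K) * a k := fun k =>
    eLpNorm_milstepDrift_le hh hp hK0 hphLip hpsC.continuous hLgLip (hYm k) (hWmeas k) (hlaw k)
      (hYW k) hc' hL₀0 hL₀le
  have hdm : ∀ k, AEStronglyMeasurable
      (fun ω => milstepDrift (T / N) ph ps g (Y k ω) (ΔW k ω)) P := fun k =>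
    (measurable_milstepDrift hh.le hph hpsC.continuous hL (hYm k) (hWmeas k)).aestronglyMeasurable
  have haE : ∀ n, a n ≤ eLpNorm (Y 0) (ENNReal.ofReal p) P + ∑ k ∈ range n,
      (ENNReal.ofReal (T / N * ‖ph 0‖ + 1 + c' * (T / N) * L₀)
        + ENNReal.ofReal (T / N * K + c' * (T / N) * K) * a k) + q n := by
    intro n
    have hs : AEStronglyMeasurable (∑ k ∈ range n,
        fun ω => milstepDrift (T / N) ph ps g (Y k ω) (ΔW k ω)) P :=
      Finset.aestronglyMeasurable_sum _ fun k _ => hdm k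
    calc a n = eLpNorm (Y 0 + ∑ k ∈ range n,
          (fun ω => milstepDrift (T / N) ph ps g (Y k ω) (ΔW k ω)) + gaussianPart g Y ΔW n)
          (ENNReal.ofReal p) P := by rw [← milstep_iterate_eq hYrec n]
      _ ≤ _ := (eLpNorm_add_le (hξmeas.aestronglyMeasurable.add hs)
          (measurable_gaussianPart hg hYm hWmeas n).aestronglyMeasurable hp1).trans
          (add_le_add ((eLpNorm_add_le hξmeas.aestronglyMeasurable hs hp1).trans
            (add_le_add le_rfl ((eLpNorm_sum_le (fun k _ => hdm k) hp1).trans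
              (Finset.sum_le_sum fun k _ => hdrift k)))) le_rfl)
  have hqE : ∀ n, q n ^ 2 ≤ ∑ k ∈ range n, ENNReal.ofReal (p ^ 2 * m * (T / N))
      * (ENNReal.ofReal ‖Gclm g 0‖ + ENNReal.ofReal K * a k) ^ 2 := by
    intro n
    induction n with
    | zero =>
      have e : gaussianPart g Y ΔW 0 = 0 := by ext1 ω; simp [gaussianPart]
      simp [hq, e]
    | succ n ih =>
      rw [Finset.sum_range_succ]
      exact (eLpNorm_gaussianPart_succ_sq_le hh hp hK0 hgLip hYm hWmeas (hlaw n) (hind n)).trans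
        (add_le_add ih le_rfl)
  have hfin := ne_top_of_le_add_sum hξLp.eLpNorm_ne_top ENNReal.ofReal_ne_top ENNReal.ofReal_ne_top
    ENNReal.ofReal_ne_top ENNReal.ofReal_ne_top ENNReal.ofReal_ne_top haE hqE
  intro n hn
  refine (ENNReal.le_ofReal_iff_toReal_le (hfin n).1 (by positivity)).2 ?_
  refine le_two_mul_exp_of_drift_of_quadratic hN hT hK0 (by linarith) hc'0 ENNReal.toReal_nonneg
    (norm_nonneg _) hL₀0 (norm_nonneg _) (a := fun n => (a n).toReal) (q := fun n => (q n).toReal)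
    (fun n => ENNReal.toReal_nonneg) (fun n _ => ?_) (fun n => ?_) n hn
  · exact toReal_le_add_sum (by positivity) (by positivity) (fun k => (hfin k).1)
      hξLp.eLpNorm_ne_top (hfin n).2 (haE n)
  · exact toReal_sq_le_sum_sq (by positivity) (norm_nonneg _) hK0 (fun k => (hfin k).1) (hqE n)
end
end

section
/- Deterministic taming inequality (inequalities (4.9)–(4.11)): let ϕ, φ : ℝ^d → ℝ^d, let K, v, v̄ ≥ 0 with 2v > v̄ and α ≥ 1, and assume for all x ∈ ℝ^d: ‖ϕ(x)‖ ≤ K‖x‖, ⟨x, φ(x)⟩ ≤ −v‖x‖^{α+1}, and ‖φ(x)‖ ≤ v̄‖x‖^α. Then for every stepsize h with 0 < h < h₁ := min( (2v−v̄)/(2Kv̄), 2v/((2K+v̄)v̄) ) and every x ∈ ℝ^d: ‖φ(x)‖²h²/(1+‖φ(x)‖h)² + 2⟨x + ϕ(x)h, φ(x)h⟩/(1+‖φ(x)‖h) ≤ 0. -/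
open MeasureTheory ProbabilityTheory Real Finset
open scoped RealInnerProductSpace ENNReal NNReal

noncomputable section

/-- Deterministic taming inequality (4.9)-(4.11). -/
theorem taming_inequality
    (d : ℕ) (hd : 0 < d) (ph ps : Vec d → Vec d)
    (K v vb α : ℝ) (hK : 0 ≤ K) (hv : 0 ≤ v) (hvb : 0 ≤ vb)
    (hvvb : vb < 2 * v) (hα : 1 ≤ α)
    (hph : ∀ x : Vec d, ‖ph x‖ ≤ K * ‖x‖)
    (hpsm : ∀ x : Vec d, ⟪x, ps x⟫ ≤ -v * ‖x‖ ^ (α + 1))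
    (hpsb : ∀ x : Vec d, ‖ps x‖ ≤ vb * ‖x‖ ^ α)
    (h : ℝ) (hh : 0 < h)
    (hh1 : 2 * K * vb ≠ 0 → h < (2 * v - vb) / (2 * K * vb))
    (hh2 : (2 * K + vb) * vb ≠ 0 → h < 2 * v / ((2 * K + vb) * vb))
    (x : Vec d) :
    ‖ps x‖ ^ 2 * h ^ 2 / (1 + ‖ps x‖ * h) ^ 2
      + 2 * ⟪x + h • ph x, h • ps x⟫ / (1 + ‖ps x‖ * h) ≤ 0 := by
  have hcoef1 : 2 * K * vb * h ≤ 2 * v - vb := by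
    rcases eq_or_ne (2 * K * vb) 0 with h0 | h0
    · rw [h0]; linarith
    · have hpos : 0 < 2 * K * vb := lt_of_le_of_ne (by positivity) h0.symm
      have := (lt_div_iff₀ hpos).1 (hh1 h0)
      linarith
  have hcoef2 : (2 * K + vb) * vb * h ≤ 2 * v := by
    rcases eq_or_ne ((2 * K + vb) * vb) 0 with h0 | h0
    · rw [h0]; linarith
    · have hpos : 0 < (2 * K + vb) * vb := lt_of_le_of_ne (by positivity) h0.symm
      have := (lt_div_iff₀ hpos).1 (hh2 h0)
      linarith
  have hr : 0 ≤ ‖x‖ := norm_nonneg x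
  have hp : 0 ≤ ‖ps x‖ := norm_nonneg _
  have hR : 0 ≤ ‖x‖ ^ α := by positivity
  have hpow : ‖x‖ ^ (α + 1) = ‖x‖ ^ α * ‖x‖ := by
    rw [Real.rpow_add' hr (by linarith), Real.rpow_one]
  have hsmall : ‖x‖ ≤ 1 → ‖x‖ ^ α ≤ ‖x‖ := fun hx => by
    simpa using Real.rpow_le_rpow_of_exponent_ge' hr hx zero_le_one hα
  have hI := hpsm x
  rw [hpow] at hI
  have hJ : ⟪ph x, ps x⟫ ≤ K * ‖x‖ * ‖ps x‖ :=
    (real_inner_le_norm _ _).trans (mul_le_mul_of_nonneg_right (hph x) hp)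
  have hps := hpsb x
  have hinner : ⟪x + h • ph x, h • ps x⟫ = h * (⟪x, ps x⟫ + h * ⟪ph x, ps x⟫) := by
    rw [inner_smul_right, inner_add_left, real_inner_smul_left]
  rw [hinner]
  generalize ‖x‖ ^ α = R at *
  generalize ‖x‖ = r at *
  generalize ‖ps x‖ = p at *
  generalize ⟪x, ps x⟫ = I at *
  generalize ⟪ph x, ps x⟫ = J at *
  have hden : 0 < 1 + p * h := by positivity
  have hRr : 0 ≤ R * r := mul_nonneg hR hr
  have hdrift : 2 * (I + h * J) ≤ -((2 * v - 2 * K * vb * h) * (R * r)) := by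
    have h1 : h * J ≤ h * (K * r * (vb * R)) := by
      gcongr
      exact hJ.trans (by gcongr)
    linarith
  have hquad : p ^ 2 * h ≤ (1 + p * h) * ((2 * v - 2 * K * vb * h) * (R * r)) := by
    have hc : 0 ≤ 2 * v - 2 * K * vb * h := by linarith
    rcases le_total r 1 with hr1 | hr1
    · calc p ^ 2 * h ≤ (vb * R) ^ 2 * h := by gcongr
        _ = vb * vb * h * (R * R) := by ring
        _ ≤ vb * vb * h * (R * r) := by gcongr; exact hsmall hr1
        _ ≤ (2 * v - 2 * K * vb * h) * (R * r) := by gcongr; linarith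
        _ ≤ _ := le_mul_of_one_le_left (by positivity) (by linarith [mul_nonneg hp hh.le])
    · calc p ^ 2 * h = p * h * p := by ring
        _ ≤ p * h * (vb * R) := by gcongr
        _ ≤ p * h * ((2 * v - 2 * K * vb * h) * (R * r)) := by
          gcongr
          · linarith
          · exact le_mul_of_one_le_right hR hr1
        _ ≤ _ := by gcongr; linarith
  have hnum : p ^ 2 * h + (1 + p * h) * (2 * (I + h * J)) ≤ 0 := by
    linarith [mul_le_mul_of_nonneg_left hdrift hden.le]
  have heq : p ^ 2 * h ^ 2 / (1 + p * h) ^ 2 + 2 * (h * (I + h * J)) / (1 + p * h)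
      = h * (p ^ 2 * h + (1 + p * h) * (2 * (I + h * J))) / (1 + p * h) ^ 2 := by
    field_simp
  rw [heq]
  exact div_nonpos_of_nonpos_of_nonneg (mul_nonpos_of_nonneg_of_nonpos hh.le hnum) (by positivity)
end
end

section
/- One-step mean-square contraction of the semi-tamed Milstein scheme (the key estimate (4.16)): under Assumption 4.1, let 0 < h < h₁ := min( (2v−v̄)/(2Kv̄), 2v/((2K+v̄)v̄) ), let Y : Ω → ℝ^d be a random vector with finite moments of all orders, and let ΔW : Ω → ℝ^m be independent of Y with law the m-fold product of the real Gaussian measure with mean 0 and variance h. Define the one-step map Y⁺ = Y + ϕ(Y)h + φ(Y)h/(1+‖φ(Y)‖h) + g(Y)ΔW + (1/2)·Σ_{j₁,j₂=1}^m L^{j₁}g_{j₂}(Y)(ΔW^{j₁}ΔW^{j₂} − δ_{j₁,j₂}h). Then E‖Y⁺‖² ≤ (1 − 2ρh + K²h² + θ²h + (m²/4)(m²+m)β²h²)·E‖Y‖². -/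
open MeasureTheory ProbabilityTheory Real Finset
open scoped RealInnerProductSpace ENNReal NNReal

noncomputable section

/-- The fourth moment of a centered real Gaussian of variance `v` is `3 * v ^ 2`. -/
lemma integral_pow_four_gaussianReal (v : ℝ≥0) :
    ∫ x, x ^ 4 ∂gaussianReal 0 v = 3 * (v : ℝ) ^ 2 := by
  have hmgf : mgf id (gaussianReal 0 v) = fun t => Real.exp ((v : ℝ) * t ^ 2 / 2) := by
    rw [mgf_id_gaussianReal]
    simp
  have hint : (0 : ℝ) ∈ interior (integrableExpSet id (gaussianReal 0 v)) := by
    rw [integrableExpSet_id_gaussianReal]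
    simp
  have hmom := iteratedDeriv_mgf_zero hint 4
  have hexp (t : ℝ) : HasDerivAt (fun t => Real.exp ((v : ℝ) * t ^ 2 / 2))
      (Real.exp ((v : ℝ) * t ^ 2 / 2) * (v * t)) t := by
    have hpow := ((hasDerivAt_pow 2 t).const_mul (v : ℝ)).div_const 2
    convert hpow.exp using 1
    push_cast
    ring
  have hpoly (p q : ℝ → ℝ) (hp : ∀ t, HasDerivAt p (q t) t) :
      deriv (fun t => p t * Real.exp ((v : ℝ) * t ^ 2 / 2))
        = fun t => (q t + v * t * p t) * Real.exp ((v : ℝ) * t ^ 2 / 2) := by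
    ext t
    rw [((hp t).fun_mul (hexp t)).deriv]
    ring
  have hd1 : deriv (fun t => Real.exp ((v : ℝ) * t ^ 2 / 2))
      = fun t => (v * t) * Real.exp ((v : ℝ) * t ^ 2 / 2) := by
    ext t
    rw [(hexp t).deriv]
    ring
  have hd2 := hpoly (fun t => v * t) (fun _ => v)
    (fun t => by simpa using (hasDerivAt_id' t).const_mul (v : ℝ))
  have hd3 := hpoly (fun t => v + v * t * (v * t)) (fun t => 2 * v ^ 2 * t) (fun t => by
    have hl := (hasDerivAt_id' t).const_mul (v : ℝ)
    exact ((hl.fun_mul hl).const_add (v : ℝ)).congr_deriv (by ring))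
  have hd4 := hpoly (fun t => 2 * v ^ 2 * t + v * t * (v + v * t * (v * t)))
    (fun t => 3 * v ^ 2 + 3 * v ^ 3 * t ^ 2) (fun t => by
    have hl := (hasDerivAt_id' t).const_mul (v : ℝ)
    have hl2 := (hasDerivAt_id' t).const_mul (2 * (v : ℝ) ^ 2)
    exact (hl2.fun_add (hl.fun_mul ((hl.fun_mul hl).const_add (v : ℝ)))).congr_deriv (by ring))
  rw [hmgf, iteratedDeriv_succ', iteratedDeriv_succ', iteratedDeriv_succ', iteratedDeriv_succ',
    iteratedDeriv_zero, hd1, hd2, hd3, hd4] at hmom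
  simpa using hmom.symm

/-- The second moment of a centered real Gaussian of variance `v` is `v`. -/
lemma integral_sq_gaussianReal (v : ℝ≥0) : ∫ x, x ^ 2 ∂gaussianReal 0 v = v := by
  rw [← variance_fun_id_gaussianReal (μ := 0) (v := v),
    variance_of_integral_eq_zero (by fun_prop) (by simp)]

section GaussianVector

variable {ι : Type*} [Fintype ι]

/-- The law of a Gaussian vector with independent centered coordinates of variance `v`. -/
abbrev piGaussian (ι : Type*) [Fintype ι] (v : ℝ≥0) : Measure (ι → ℝ) :=
  Measure.pi fun _ => gaussianReal 0 v

lemma memLp_eval_piGaussian (v : ℝ≥0) (i : ι) (p : ℝ≥0∞) (hp : p ≠ ∞) :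
    MemLp (fun w : ι → ℝ => w i) p (piGaussian ι v) :=
  (memLp_id_gaussianReal' p hp).comp_measurePreserving
    (measurePreserving_eval (fun _ : ι => gaussianReal 0 v) i)

lemma integral_comp_eval_piGaussian (v : ℝ≥0) (i : ι) (n : ℕ) :
    ∫ w, w i ^ n ∂piGaussian ι v = ∫ x, x ^ n ∂gaussianReal 0 v := by
  rw [← (measurePreserving_eval (fun _ : ι => gaussianReal 0 v) i).map_eq,
    integral_map (measurable_pi_apply i).aemeasurable (by fun_prop)]

/-- Odd functions have vanishing integral against a centered Gaussian vector. -/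
lemma integral_piGaussian_of_odd (v : ℝ≥0) (f : (ι → ℝ) → ℝ) (hf : ∀ w, f (-w) = -f w) :
    ∫ w, f w ∂piGaussian ι v = 0 := by
  have hneg : MeasurePreserving (fun w : ι → ℝ => fun i => -w i) (piGaussian ι v)
      (piGaussian ι v) :=
    measurePreserving_pi _ _ fun _ => ⟨measurable_neg, gaussianReal_map_neg.trans (by simp)⟩
  have hcomp := hneg.integral_comp (MeasurableEquiv.neg (ι → ℝ)).measurableEmbedding f
  have hodd : ∫ w, f (fun i => -w i) ∂piGaussian ι v = -∫ w, f w ∂piGaussian ι v := by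
    rw [← integral_neg]
    exact integral_congr_ae (ae_of_all _ hf)
  linarith

lemma integral_pow_mul_pow_piGaussian (v : ℝ≥0) {i j : ι} (hij : i ≠ j) (n : ℕ) :
    ∫ w, w i ^ n * w j ^ n ∂piGaussian ι v = (∫ x, x ^ n ∂gaussianReal 0 v) ^ 2 := by
  have hind : iIndepFun (fun (i : ι) (w : ι → ℝ) => w i ^ n) (piGaussian ι v) :=
    iIndepFun_pi (X := fun _ x => x ^ n) fun _ => by fun_prop
  rw [(hind.indepFun hij).integral_fun_mul_eq_mul_integral
      ((measurable_pi_apply i).pow_const n).aestronglyMeasurable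
      ((measurable_pi_apply j).pow_const n).aestronglyMeasurable,
    integral_comp_eval_piGaussian, integral_comp_eval_piGaussian, sq]

/-- The centered product `w i * w j - δ i j * h`, the weight of `L^i g_j` in twice the Milstein
correction over a step of length `h`. -/
def milsteinCoeff (h : ℝ) [DecidableEq ι] (w : ι → ℝ) (i j : ι) : ℝ :=
  w i * w j - if i = j then h else 0

lemma memLp_eval_mul_eval_piGaussian (v : ℝ≥0) (i j : ι) :
    MemLp (fun w : ι → ℝ => w i * w j) 2 (piGaussian ι v) := by
  have : ENNReal.HolderTriple 4 4 2 := ⟨by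
    rw [← two_mul, show (4 : ℝ≥0∞) = 2 * 2 by norm_num,
      ENNReal.mul_inv (by simp) (by simp), ← mul_assoc, ENNReal.mul_inv_cancel (by simp) (by simp),
      one_mul]⟩
  exact (memLp_eval_piGaussian v j 4 (by simp)).mul (memLp_eval_piGaussian v i 4 (by simp))

variable [DecidableEq ι]

lemma memLp_milsteinCoeff (v : ℝ≥0) (h : ℝ) (i j : ι) :
    MemLp (fun w => milsteinCoeff h w i j) 2 (piGaussian ι v) :=
  (memLp_eval_mul_eval_piGaussian v i j).sub (memLp_const _)

lemma integral_eval_mul_eval_piGaussian (v : ℝ≥0) (i j : ι) :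
    ∫ w, w i * w j ∂piGaussian ι v = if i = j then (v : ℝ) else 0 := by
  split_ifs with hij
  · subst hij
    simpa [sq] using (integral_comp_eval_piGaussian v i 2).trans (integral_sq_gaussianReal v)
  · simpa using integral_pow_mul_pow_piGaussian v hij 1

lemma integral_milsteinCoeff (v : ℝ≥0) (i j : ι) :
    ∫ w, milsteinCoeff v w i j ∂piGaussian ι v = 0 := by
  unfold milsteinCoeff
  rw [integral_sub ((memLp_eval_mul_eval_piGaussian v i j).integrable (by norm_num))
    (integrable_const _), integral_eval_mul_eval_piGaussian]
  simp

lemma integral_milsteinCoeff_sq (v : ℝ≥0) (i j : ι) :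
    ∫ w, milsteinCoeff v w i j ^ 2 ∂piGaussian ι v
      = (v : ℝ) ^ 2 + if i = j then (v : ℝ) ^ 2 else 0 := by
  have hsq : Integrable (fun w : ι → ℝ => w i ^ 2 * w j ^ 2) (piGaussian ι v) := by
    simpa [mul_pow] using (memLp_eval_mul_eval_piGaussian v i j).integrable_sq
  split_ifs with hij
  · subst hij
    have hexpand (w : ι → ℝ) : milsteinCoeff v w i i ^ 2
        = w i ^ 2 * w i ^ 2 - 2 * v * w i ^ 2 + (v : ℝ) ^ 2 := by
      simp [milsteinCoeff]
      ring
    have h2 : Integrable (fun w : ι → ℝ => 2 * v * w i ^ 2) (piGaussian ι v) :=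
      (memLp_eval_piGaussian v i 2 (by simp)).integrable_sq.const_mul _
    have h24 : Integrable (fun w : ι → ℝ => w i ^ 2 * w i ^ 2 - 2 * v * w i ^ 2)
        (piGaussian ι v) := hsq.sub h2
    have h4 : ∫ w, w i ^ 2 * w i ^ 2 ∂piGaussian ι v = 3 * (v : ℝ) ^ 2 := by
      rw [← integral_pow_four_gaussianReal v, ← integral_comp_eval_piGaussian v i 4]
      simp [← pow_add]
    simp_rw [hexpand]
    rw [integral_add h24 (integrable_const _), integral_sub hsq h2, h4,
      integral_const_mul, integral_comp_eval_piGaussian, integral_sq_gaussianReal]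
    simp
    ring
  · simp [milsteinCoeff, hij, mul_pow, integral_pow_mul_pow_piGaussian v hij,
      integral_sq_gaussianReal]

variable {E : Type*} [NormedAddCommGroup E] [InnerProductSpace ℝ E]

/-- A quadratic majorant, polynomial in the increment, of the squared norm of a Milstein step. -/
lemma norm_sq_milstein_le (h : ℝ) (a : E) (G : ι → E) (L : ι → ι → E) (B : ℝ)
    (hL : ∀ i j, ‖L i j‖ ≤ B) (w : ι → ℝ) :
    ‖a + ∑ j, w j • G j + (2⁻¹ : ℝ) • ∑ i, ∑ j, milsteinCoeff h w i j • L i j‖ ^ 2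
      ≤ ‖a‖ ^ 2 + ∑ i, ∑ j, w i * w j * ⟪G i, G j⟫
        + ∑ i, ∑ j, milsteinCoeff h w i j ^ 2 * ((Fintype.card ι : ℝ) ^ 2 / 4 * B ^ 2)
        + ∑ i, w i * (2 * ⟪a, G i⟫) + ∑ i, ∑ j, milsteinCoeff h w i j * ⟪a, L i j⟫
        + ∑ k, ∑ i, ∑ j, w k * milsteinCoeff h w i j * ⟪G k, L i j⟫ := by
  set c := milsteinCoeff h w
  set S := ∑ j, w j • G j with hS
  set M := ∑ i, ∑ j, c i j • L i j with hM
  have hSS : ‖S‖ ^ 2 = ∑ i, ∑ j, w i * w j * ⟪G i, G j⟫ := by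
    rw [← real_inner_self_eq_norm_sq, hS, sum_inner]
    simp only [inner_sum, real_inner_smul_left, real_inner_smul_right]
    exact sum_congr rfl fun i _ => sum_congr rfl fun j _ => by ring
  have haS : 2 * ⟪a, S⟫ = ∑ i, w i * (2 * ⟪a, G i⟫) := by
    rw [hS, inner_sum, mul_sum]
    exact sum_congr rfl fun i _ => by rw [real_inner_smul_right]; ring
  have haM : ⟪a, M⟫ = ∑ i, ∑ j, c i j * ⟪a, L i j⟫ := by
    simp only [hM, inner_sum, real_inner_smul_right]
  have hSM : ⟪S, M⟫ = ∑ k, ∑ i, ∑ j, w k * c i j * ⟪G k, L i j⟫ := by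
    rw [hS, sum_inner]
    simp only [hM, inner_sum, real_inner_smul_left, real_inner_smul_right]
    exact sum_congr rfl fun k _ => sum_congr rfl fun i _ => sum_congr rfl fun j _ => by ring
  have hMnorm : ‖M‖ ≤ ∑ p : ι × ι, |c p.1 p.2| * B := by
    rw [hM, ← Fintype.sum_prod_type']
    refine norm_sum_le_of_le _ fun p _ => ?_
    rw [norm_smul, Real.norm_eq_abs]
    exact mul_le_mul_of_nonneg_left (hL _ _) (abs_nonneg _)
  have hMM : ‖M‖ ^ 2 / 4
      ≤ ∑ i, ∑ j, c i j ^ 2 * ((Fintype.card ι : ℝ) ^ 2 / 4 * B ^ 2) := by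
    have hcs := sq_sum_le_card_mul_sum_sq (s := (univ : Finset (ι × ι)))
      (f := fun p => |c p.1 p.2| * B)
    have hsq := pow_le_pow_left₀ (norm_nonneg M) hMnorm 2
    rw [← Fintype.sum_prod_type' (f := fun i j =>
      c i j ^ 2 * ((Fintype.card ι : ℝ) ^ 2 / 4 * B ^ 2)), ← sum_mul]
    simp only [mul_pow, sq_abs, ← sum_mul, card_univ, Fintype.card_prod] at hcs
    push_cast at hcs
    rw [← sum_mul] at hsq
    linarith
  have hexpand : ‖a + S + (2⁻¹ : ℝ) • M‖ ^ 2
      = ‖a‖ ^ 2 + ‖S‖ ^ 2 + ‖M‖ ^ 2 / 4 + 2 * ⟪a, S⟫ + ⟪a, M⟫ + ⟪S, M⟫ := by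
    rw [norm_add_sq_real, norm_add_sq_real, inner_add_left, real_inner_smul_right,
      real_inner_smul_right, norm_smul, mul_pow]
    norm_num
    ring
  rw [hexpand, ← hSS, ← haS, ← haM, ← hSM]
  linarith

/-- Mean-square bound for one Milstein step from a deterministic state. -/
lemma lintegral_norm_sq_milstein_le (v : ℝ≥0) (a : E) (G : ι → E) (L : ι → ι → E) (B : ℝ)
    (hL : ∀ i j, ‖L i j‖ ≤ B) :
    ∫⁻ w, ENNReal.ofReal
      (‖a + ∑ j, w j • G j + (2⁻¹ : ℝ) • ∑ i, ∑ j, milsteinCoeff v w i j • L i j‖ ^ 2)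
        ∂piGaussian ι v
      ≤ ENNReal.ofReal (‖a‖ ^ 2 + v * ∑ j, ‖G j‖ ^ 2
        + (Fintype.card ι : ℝ) ^ 2 / 4 * ((Fintype.card ι : ℝ) ^ 2 + Fintype.card ι)
          * B ^ 2 * (v : ℝ) ^ 2) := by
  have hpt (w : ι → ℝ) := norm_sq_milstein_le (v : ℝ) a G L B hL w
  set F : (ι → ℝ) → ℝ := fun w => ‖a‖ ^ 2 + ∑ i, ∑ j, w i * w j * ⟪G i, G j⟫
        + ∑ i, ∑ j, milsteinCoeff v w i j ^ 2 * ((Fintype.card ι : ℝ) ^ 2 / 4 * B ^ 2)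
        + ∑ i, w i * (2 * ⟪a, G i⟫) + ∑ i, ∑ j, milsteinCoeff v w i j * ⟪a, L i j⟫
        + ∑ k, ∑ i, ∑ j, w k * milsteinCoeff v w i j * ⟪G k, L i j⟫ with hF
  have i1 (i j : ι) : Integrable (fun w : ι → ℝ => w i * w j * ⟪G i, G j⟫) (piGaussian ι v) :=
    ((memLp_eval_mul_eval_piGaussian v i j).integrable (by norm_num)).mul_const _
  have i2 (i j : ι) : Integrable (fun w : ι → ℝ => milsteinCoeff v w i j ^ 2
      * ((Fintype.card ι : ℝ) ^ 2 / 4 * B ^ 2)) (piGaussian ι v) :=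
    (memLp_milsteinCoeff v v i j).integrable_sq.mul_const _
  have i3 (i : ι) : Integrable (fun w : ι → ℝ => w i * (2 * ⟪a, G i⟫)) (piGaussian ι v) :=
    ((memLp_eval_piGaussian v i 1 (by simp)).integrable le_rfl).mul_const _
  have i4 (i j : ι) : Integrable (fun w : ι → ℝ => milsteinCoeff v w i j * ⟪a, L i j⟫)
      (piGaussian ι v) :=
    ((memLp_milsteinCoeff v v i j).integrable (by norm_num)).mul_const _
  have i5 (k i j : ι) : Integrable
      (fun w : ι → ℝ => w k * milsteinCoeff v w i j * ⟪G k, L i j⟫) (piGaussian ι v) :=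
    ((memLp_eval_piGaussian v k 2 (by simp)).integrable_mul
      (memLp_milsteinCoeff v v i j)).mul_const _
  have s1 := integrable_finsetSum univ fun i _ => integrable_finsetSum univ fun j _ => i1 i j
  have s2 := integrable_finsetSum univ fun i _ => integrable_finsetSum univ fun j _ => i2 i j
  have s3 := integrable_finsetSum univ fun i _ => i3 i
  have s4 := integrable_finsetSum univ fun i _ => integrable_finsetSum univ fun j _ => i4 i j
  have s5 := integrable_finsetSum univ fun k _ => integrable_finsetSum univ fun i _ =>
    integrable_finsetSum univ fun j _ => i5 k i j
  have s0 : Integrable (fun _ : ι → ℝ => ‖a‖ ^ 2) (piGaussian ι v) := integrable_const _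
  have hFint : Integrable F (piGaussian ι v) := ((((s0.add s1).add s2).add s3).add s4).add s5
  have hFval : ∫ w, F w ∂piGaussian ι v = ‖a‖ ^ 2 + v * ∑ j, ‖G j‖ ^ 2
        + (Fintype.card ι : ℝ) ^ 2 / 4 * ((Fintype.card ι : ℝ) ^ 2 + Fintype.card ι)
          * B ^ 2 * (v : ℝ) ^ 2 := by
    have e1 : ∫ w : ι → ℝ, ∑ i, ∑ j, w i * w j * ⟪G i, G j⟫ ∂piGaussian ι v
        = v * ∑ j, ‖G j‖ ^ 2 := by
      rw [integral_finsetSum _ fun i _ => integrable_finsetSum _ fun j _ => i1 i j, mul_sum]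
      refine sum_congr rfl fun i _ => ?_
      rw [integral_finsetSum _ fun j _ => i1 i j]
      simp [integral_mul_const, integral_eval_mul_eval_piGaussian]
    have e2 : ∫ w : ι → ℝ, ∑ i, ∑ j, milsteinCoeff v w i j ^ 2
        * ((Fintype.card ι : ℝ) ^ 2 / 4 * B ^ 2) ∂piGaussian ι v
        = (Fintype.card ι : ℝ) ^ 2 / 4 * ((Fintype.card ι : ℝ) ^ 2 + Fintype.card ι)
          * B ^ 2 * (v : ℝ) ^ 2 := by
      rw [integral_finsetSum _ fun i _ => integrable_finsetSum _ fun j _ => i2 i j]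
      simp_rw [integral_finsetSum _ fun j _ => i2 _ j, integral_mul_const,
        integral_milsteinCoeff_sq, ← sum_mul, sum_add_distrib]
      simp
      ring
    have e3 : ∫ w : ι → ℝ, ∑ i, w i * (2 * ⟪a, G i⟫) ∂piGaussian ι v = 0 :=
      integral_piGaussian_of_odd v _ fun w => by simp
    have e4 : ∫ w : ι → ℝ, ∑ i, ∑ j, milsteinCoeff v w i j * ⟪a, L i j⟫ ∂piGaussian ι v = 0 := by
      rw [integral_finsetSum _ fun i _ => integrable_finsetSum _ fun j _ => i4 i j]
      simp_rw [integral_finsetSum _ fun j _ => i4 _ j, integral_mul_const,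
        integral_milsteinCoeff]
      simp
    have e5 : ∫ w : ι → ℝ, ∑ k, ∑ i, ∑ j, w k * milsteinCoeff v w i j * ⟪G k, L i j⟫
        ∂piGaussian ι v = 0 :=
      integral_piGaussian_of_odd v _ fun w => by simp [milsteinCoeff]
    simp only [hF]
    rw [integral_add ((((s0.fun_add s1).fun_add s2).fun_add s3).fun_add s4) s5,
      integral_add (((s0.fun_add s1).fun_add s2).fun_add s3) s4,
      integral_add ((s0.fun_add s1).fun_add s2) s3,
      integral_add (s0.fun_add s1) s2, integral_add s0 s1, e1, e2, e3, e4, e5]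
    simp
  rw [← hFval, ofReal_integral_eq_lintegral_ofReal hFint
    (ae_of_all _ fun w => (sq_nonneg _).trans (hpt w))]
  exact lintegral_mono fun w => ENNReal.ofReal_le_ofReal (hpt w)

end GaussianVector

/-- The semi-tamed drift step is as contractive as its Lipschitz part alone. -/
lemma norm_sq_tamed_drift_le {E : Type*} [NormedAddCommGroup E] [InnerProductSpace ℝ E]
    {K ρ v vb α h : ℝ} (hK : 0 ≤ K) (hvb : 0 ≤ vb) (hα : 1 < α) (hh : 0 < h)
    (hlarge : 2 * K * vb * h ≤ 2 * v - vb) (hsmall : (2 * K + vb) * vb * h ≤ 2 * v)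
    (y f s : E) (hyf : ⟪y, f⟫ ≤ -ρ * ‖y‖ ^ 2) (hf : ‖f‖ ≤ K * ‖y‖)
    (hys : ⟪y, s⟫ ≤ -v * ‖y‖ ^ (α + 1)) (hs : ‖s‖ ≤ vb * ‖y‖ ^ α) :
    ‖y + h • f + (h / (1 + ‖s‖ * h)) • s‖ ^ 2 ≤ (1 - 2 * ρ * h + K ^ 2 * h ^ 2) * ‖y‖ ^ 2 := by
  set t := h / (1 + ‖s‖ * h) with ht
  have hden : 0 < 1 + ‖s‖ * h := by positivity
  have ht0 : 0 ≤ t := by positivity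
  have hth : t ≤ h := div_le_self hh.le (by nlinarith [norm_nonneg s])
  have hts : t * ‖s‖ ≤ 1 := by
    rw [ht, div_mul_eq_mul_div, div_le_one hden]
    linarith
  set q := ‖y‖ ^ (α + 1) with hq
  have hq0 : 0 ≤ q := by positivity
  have hqmul : ‖y‖ * ‖y‖ ^ α = q := by
    rcases (norm_nonneg y).eq_or_lt with hy | hy
    · rw [hq, ← hy, zero_mul, Real.zero_rpow (by linarith)]
    · rw [hq, Real.rpow_add_one hy.ne', mul_comm]
  have hfs : ⟪f, s⟫ ≤ K * vb * q := by
    calc ⟪f, s⟫ ≤ ‖f‖ * ‖s‖ := real_inner_le_norm f s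
      _ ≤ (K * ‖y‖) * (vb * ‖y‖ ^ α) := by gcongr
      _ = K * vb * q := by rw [← hqmul]; ring
  have hkey : 2 * ⟪y, s⟫ + 2 * h * ⟪f, s⟫ + t * ‖s‖ ^ 2 ≤ 0 := by
    have hfs' : h * ⟪f, s⟫ ≤ h * (K * vb * q) := by gcongr
    rcases le_total 1 ‖y‖ with hy | hy
    · have hpow : ‖y‖ ^ α ≤ q := Real.rpow_le_rpow_of_exponent_le hy (by linarith)
      have hlast : t * ‖s‖ ^ 2 ≤ vb * q := by
        calc t * ‖s‖ ^ 2 = t * ‖s‖ * ‖s‖ := by ring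
          _ ≤ 1 * ‖s‖ := by gcongr
          _ ≤ vb * q := by
            rw [one_mul]
            exact hs.trans (by gcongr)
      nlinarith
    · have hpow : ‖y‖ ^ α ≤ ‖y‖ := by
        simpa using Real.rpow_le_rpow_of_exponent_ge_of_imp (norm_nonneg y) hy hα.le
          fun _ hα0 => by linarith
      have hlast : t * ‖s‖ ^ 2 ≤ h * (vb ^ 2 * q) := by
        calc t * ‖s‖ ^ 2 ≤ h * (vb * ‖y‖ ^ α) ^ 2 := by gcongr
          _ = h * (vb ^ 2 * (‖y‖ ^ α * ‖y‖ ^ α)) := by ring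
          _ ≤ h * (vb ^ 2 * (‖y‖ * ‖y‖ ^ α)) := by gcongr
          _ = h * (vb ^ 2 * q) := by rw [hqmul]
      nlinarith
  have hff : h ^ 2 * ‖f‖ ^ 2 ≤ h ^ 2 * (K * ‖y‖) ^ 2 := by gcongr
  have hexpand : ‖y + h • f + t • s‖ ^ 2 = ‖y‖ ^ 2 + 2 * h * ⟪y, f⟫ + h ^ 2 * ‖f‖ ^ 2
      + t * (2 * ⟪y, s⟫ + 2 * h * ⟪f, s⟫ + t * ‖s‖ ^ 2) := by
    rw [norm_add_sq_real, norm_add_sq_real, inner_add_left, real_inner_smul_right,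
      real_inner_smul_right, real_inner_smul_right, real_inner_smul_left, norm_smul, norm_smul,
      mul_pow, mul_pow, Real.norm_eq_abs, Real.norm_eq_abs, sq_abs, sq_abs]
    ring
  rw [hexpand]
  nlinarith [mul_nonpos_of_nonneg_of_nonpos ht0 hkey, mul_le_mul_of_nonneg_left hyf hh.le]

lemma milstep_toLp {d m : ℕ} (h : ℝ) (ph ps : Vec d → Vec d) (g : Fin m → Vec d → Vec d)
    (y : Vec d) (w : Fin m → ℝ) :
    milstep h ph ps g y (WithLp.toLp 2 w)
      = (y + h • ph y + (h / (1 + ‖ps y‖ * h)) • ps y) + ∑ j, w j • g j y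
        + (2⁻¹ : ℝ) • ∑ i, ∑ j, milsteinCoeff h w i j • Lg g i j y := rfl

lemma continuous_milstep {d m : ℕ} {h : ℝ} (hh : 0 ≤ h) {ph ps : Vec d → Vec d}
    {g : Fin m → Vec d → Vec d} (hph : ContDiff ℝ 1 ph) (hps : ContDiff ℝ 1 ps)
    (hg : ∀ j, ContDiff ℝ 1 (g j)) :
    Continuous fun p : Vec d × Vec m => milstep h ph ps g p.1 p.2 := by
  have hLg (i j : Fin m) : Continuous (Lg g i j) :=
    ((hg j).continuous_fderiv one_ne_zero).clm_apply (hg i).continuous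
  have hphc := hph.continuous
  have hpsc := hps.continuous
  have hgc (j : Fin m) := (hg j).continuous
  have hden (p : Vec d × Vec m) : 1 + ‖ps p.1‖ * h ≠ 0 := by positivity
  have hG : Continuous fun p : Vec d × Vec m => Gclm g p.1 p.2 := by
    change Continuous fun p : Vec d × Vec m => ∑ j, p.2 j • g j p.1
    fun_prop
  unfold milstep
  fun_prop (disch := assumption)

/-- The key one-step mean-square contraction estimate (4.16). -/
theorem one_step_mean_square_contraction
    (d m : ℕ) (hd : 0 < d) (hm : 0 < m)
    (ph ps : Vec d → Vec d) (g : Fin m → Vec d → Vec d)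
    (K ρ θ v vb β : ℝ) (α : ℝ)
    (hK : 0 ≤ K) (hρ : 0 ≤ ρ) (hθ : 0 ≤ θ) (hv : 0 ≤ v) (hvb : 0 ≤ vb) (hβ : 0 ≤ β)
    (hα : 1 < α) (hρθ : θ ^ 2 < 2 * ρ) (hvvb : vb < 2 * v)
    (hph0 : ph 0 = 0) (hps0 : ps 0 = 0) (hg0 : ∀ j, g j 0 = 0)
    (hphC : ContDiff ℝ 1 ph) (hpsC : ContDiff ℝ 1 ps) (hgC : ∀ j, ContDiff ℝ 1 (g j))
    (hphm : ∀ x y : Vec d, ⟪x - y, ph x - ph y⟫ ≤ -ρ * ‖x - y‖ ^ 2)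
    (hphLip : ∀ x y : Vec d, ‖ph x - ph y‖ ≤ K * ‖x - y‖)
    (hpsm : ∀ x : Vec d, ⟪x, ps x⟫ ≤ -v * ‖x‖ ^ (α + 1))
    (hpsb : ∀ x : Vec d, ‖ps x‖ ≤ vb * ‖x‖ ^ α)
    (hgLip : ∀ x y : Vec d, Real.sqrt (∑ j, ‖g j x - g j y‖ ^ 2) ≤ θ * ‖x - y‖)
    (hLgLip : ∀ (i j : Fin m) (x y : Vec d), ‖Lg g j i x - Lg g j i y‖ ≤ β * ‖x - y‖)
    (h : ℝ) (hh : 0 < h)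
    (hh1 : 2 * K * vb ≠ 0 → h < (2 * v - vb) / (2 * K * vb))
    (hh2 : (2 * K + vb) * vb ≠ 0 → h < 2 * v / ((2 * K + vb) * vb))
    (Ω : Type) (mΩ : MeasurableSpace Ω) (P : Measure Ω) (hP : IsProbabilityMeasure P)
    (Y : Ω → Vec d) (ΔW : Ω → Vec m)
    (hYmeas : Measurable Y) (hWmeas : Measurable ΔW)
    (hYmom : ∀ r : ℕ, Integrable (fun ω => ‖Y ω‖ ^ r) P)
    (hindep : IndepFun Y ΔW P)
    (hlaw : Measure.map ΔW P
      = Measure.map (WithLp.toLp 2)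
          (Measure.pi (fun _ : Fin m => gaussianReal 0 (Real.toNNReal h)))) :
    ∫⁻ ω, ENNReal.ofReal (‖milstep h ph ps g (Y ω) (ΔW ω)‖ ^ 2) ∂P
      ≤ ENNReal.ofReal (1 - 2 * ρ * h + K ^ 2 * h ^ 2 + θ ^ 2 * h
            + (m : ℝ) ^ 2 / 4 * ((m : ℝ) ^ 2 + m) * β ^ 2 * h ^ 2)
          * ∫⁻ ω, ENNReal.ofReal (‖Y ω‖ ^ 2) ∂P := by
  set C : ℝ := 1 - 2 * ρ * h + K ^ 2 * h ^ 2 + θ ^ 2 * h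
    + (m : ℝ) ^ 2 / 4 * ((m : ℝ) ^ 2 + m) * β ^ 2 * h ^ 2 with hC
  have hlarge : 2 * K * vb * h ≤ 2 * v - vb := by
    rcases eq_or_ne (2 * K * vb) 0 with h0 | h0
    · rw [h0]
      linarith
    · have := (lt_div_iff₀ (h0.symm.lt_of_le (by positivity))).1 (hh1 h0)
      linarith
  have hsmall : (2 * K + vb) * vb * h ≤ 2 * v := by
    rcases eq_or_ne ((2 * K + vb) * vb) 0 with h0 | h0
    · rw [h0]
      linarith
    · have := (lt_div_iff₀ (h0.symm.lt_of_le (by positivity))).1 (hh2 h0)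
      linarith
  have hcond (y : Vec d) :
      ∫⁻ w, ENNReal.ofReal (‖milstep h ph ps g y w‖ ^ 2) ∂(Measure.map ΔW P)
        ≤ ENNReal.ofReal C * ENNReal.ofReal (‖y‖ ^ 2) := by
    have hcont := continuous_milstep hh.le hphC hpsC hgC
    have hmeas : Measurable fun w => ENNReal.ofReal (‖milstep h ph ps g y w‖ ^ 2) := by
      have := hcont.comp (Continuous.prodMk_right y)
      exact (this.norm.pow 2).measurable.ennreal_ofReal
    have hLy (i j : Fin m) : ‖Lg g i j y‖ ≤ β * ‖y‖ := by
      have hL0 : Lg g i j 0 = 0 := by simp [Lg, hg0]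
      simpa [hL0] using hLgLip j i y 0
    have hGy : ∑ j, ‖g j y‖ ^ 2 ≤ θ ^ 2 * ‖y‖ ^ 2 := by
      have hsqrt := hgLip y 0
      simp only [hg0, sub_zero] at hsqrt
      rw [← mul_pow]
      exact (Real.sqrt_le_left (by positivity)).1 hsqrt
    have hdrift := norm_sq_tamed_drift_le hK hvb hα hh hlarge hsmall y (ph y) (ps y)
      (by simpa [hph0] using hphm y 0) (by simpa [hph0] using hphLip y 0) (hpsm y) (hpsb y)
    have hstep := lintegral_norm_sq_milstein_le h.toNNReal
      (y + h • ph y + (h / (1 + ‖ps y‖ * h)) • ps y) (fun j => g j y) (fun i j => Lg g i j y)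
      (β * ‖y‖) hLy
    rw [Real.coe_toNNReal h hh.le, Fintype.card_fin] at hstep
    rw [hlaw, lintegral_map hmeas (WithLp.measurable_toLp 2 _),
      ← ENNReal.ofReal_mul' (sq_nonneg _)]
    simp only [milstep_toLp]
    refine hstep.trans (ENNReal.ofReal_le_ofReal ?_)
    rw [hC]
    nlinarith [mul_le_mul_of_nonneg_left hGy hh.le]
  have hjoint : Measurable fun p : Vec d × Vec m =>
      ENNReal.ofReal (‖milstep h ph ps g p.1 p.2‖ ^ 2) :=
    ((continuous_milstep hh.le hphC hpsC hgC).norm.pow 2).measurable.ennreal_ofReal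
  have hprob : IsProbabilityMeasure (Measure.map ΔW P) :=
    Measure.isProbabilityMeasure_map hWmeas.aemeasurable
  have hnorm : Measurable fun y : Vec d => ENNReal.ofReal (‖y‖ ^ 2) := by fun_prop
  calc ∫⁻ ω, ENNReal.ofReal (‖milstep h ph ps g (Y ω) (ΔW ω)‖ ^ 2) ∂P
      = ∫⁻ p, ENNReal.ofReal (‖milstep h ph ps g p.1 p.2‖ ^ 2)
          ∂(Measure.map (fun ω => (Y ω, ΔW ω)) P) :=
        (lintegral_map hjoint (hYmeas.prodMk hWmeas)).symm
    _ = ∫⁻ y, ∫⁻ w, ENNReal.ofReal (‖milstep h ph ps g y w‖ ^ 2)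
          ∂(Measure.map ΔW P) ∂(Measure.map Y P) := by
        rw [(indepFun_iff_map_prod_eq_prod_map_map hYmeas.aemeasurable
          hWmeas.aemeasurable).1 hindep, lintegral_prod _ hjoint.aemeasurable]
    _ ≤ ∫⁻ y, ENNReal.ofReal C * ENNReal.ofReal (‖y‖ ^ 2) ∂(Measure.map Y P) :=
        lintegral_mono hcond
    _ = ENNReal.ofReal C * ∫⁻ ω, ENNReal.ofReal (‖Y ω‖ ^ 2) ∂P := by
        rw [lintegral_const_mul _ hnorm, lintegral_map hnorm hYmeas]
end
end
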